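/- arXiv:1809.05932 — 2 statements merged into one kernel-verified Lean document; each statement's English description precedes it below -/
import Mathlib

section
/- There is an absolute constant C > 0 such that for every integer r ≥ 2, every nonempty finite set H ⊆ {-1,1}^r, and every ε ∈ (0,1), there exists a finitely supported probability distribution D over linear decision trees over ℝ^r with output values in ({-1,1}^H) ∪ {?} satisfying: (1) every tree in the support of D has depth at most C·r·(log r)·log(2|H|/ε) and all of its linear queries have integer coefficient vectors with every entry in {-2,-1,0,1,2}; (2) for every input w ∈ ℝ^r such that ⟨w,a⟩ ≠ 0 for all a ∈ {-1,1}^r, every tree in the support of D outputs on w either the symbol ? or the function a ↦ sgn(⟨w,a⟩) restricted to H (i.e., the truth table on H of the linear threshold function with weight vector w and threshold 0), and the probability over a tree T drawn from D that T outputs ? on w is at most ε. -/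
/-- A linear decision tree over `ι → ℝ` with output values in `S`:
each internal node is labeled by an integer weight vector `w : ι → ℤ` and a
real threshold `θ`; each leaf is labeled by an element of `S`. -/
inductive LDT (ι : Type) (S : Type) : Type where
  | leaf (s : S) : LDT ι S
  | node (w : ι → ℤ) (θ : ℝ) (l r : LDT ι S) : LDT ι S

namespace LDT

variable {ι S : Type}

/-- Evaluation of a linear decision tree on an input `z : ι → ℝ`:
at a node `(w, θ)` we go to the left child if `∑ i, w i * z i ≥ θ`
and to the right child otherwise. -/
noncomputable def eval [Fintype ι] : LDT ι S → (ι → ℝ) → S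
  | leaf s, _ => s
  | node w θ l r, z => if θ ≤ ∑ i, (w i : ℝ) * z i then l.eval z else r.eval z

/-- Depth: the maximum number of internal nodes on a root-to-leaf path. -/
def depth : LDT ι S → ℕ
  | leaf _ => 0
  | node _ _ l r => max l.depth r.depth + 1

/-- All linear queries in the tree have coefficients in `{-2,-1,0,1,2}`. -/
def SmallCoeffs : LDT ι S → Prop
  | leaf _ => True
  | node w _ l r =>
      (∀ i, w i ∈ ({-2, -1, 0, 1, 2} : Set ℤ)) ∧ l.SmallCoeffs ∧ r.SmallCoeffs

end LDT

namespace LDT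

open Finset

variable {r : ℕ}

/-- The pairing of a real weight vector with an integer vector. -/
noncomputable def dot (w : Fin r → ℝ) (a : Fin r → ℤ) : ℝ := ∑ i, (a i : ℝ) * w i

lemma dot_zero (w : Fin r → ℝ) : dot w 0 = 0 := by simp [dot]

lemma dot_add (w : Fin r → ℝ) (a b : Fin r → ℤ) : dot w (a + b) = dot w a + dot w b := by
  simp [dot, add_mul, sum_add_distrib]

lemma dot_sub (w : Fin r → ℝ) (a b : Fin r → ℤ) : dot w (a - b) = dot w a - dot w b := by
  simp [dot, sub_mul, sum_sub_distrib]

lemma dot_smul (w : Fin r → ℝ) (c : ℤ) (a : Fin r → ℤ) : dot w (c • a) = c * dot w a := by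
  simp [dot, mul_sum, mul_assoc]

lemma dot_sum {ι : Type*} (w : Fin r → ℝ) (s : Finset ι) (f : ι → Fin r → ℤ) :
    dot w (∑ j ∈ s, f j) = ∑ j ∈ s, dot w (f j) := by
  classical
  induction s using Finset.induction_on with
  | empty => simp [dot_zero]
  | insert a s ha ih => rw [sum_insert ha, sum_insert ha, dot_add, ih]

/-- The value of `dot w`, with ties broken by a fixed linear order on integer vectors. -/
noncomputable def key (w : Fin r → ℝ) (a : Fin r → ℤ) : ℝ ×ₗ Lex (Fin r → ℤ) :=
  toLex (dot w a, toLex a)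

lemma key_injective (w : Fin r → ℝ) : Function.Injective (key w) := by
  intro a b h
  simpa [key] using (congrArg (fun x => (ofLex x).2) h)

lemma key_lt_key {w : Fin r → ℝ} {a b : Fin r → ℤ} :
    key w a < key w b ↔ dot w a < dot w b ∨ dot w a = dot w b ∧ toLex a < toLex b := by
  simp [key, Prod.Lex.toLex_lt_toLex]

lemma dot_le_of_key_lt {w : Fin r → ℝ} {a b : Fin r → ℤ} (h : key w a < key w b) :
    dot w a ≤ dot w b := by
  rcases key_lt_key.1 h with h | h
  · exact h.le
  · exact h.1.le

lemma key_lt_key_of_lt {w : Fin r → ℝ} {a b : Fin r → ℤ} (h : toLex a < toLex b) :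
    key w a < key w b ↔ 0 ≤ dot w (b - a) := by
  rw [key_lt_key, dot_sub, sub_nonneg, le_iff_lt_or_eq]
  simp [h]

lemma key_lt_key_of_gt {w : Fin r → ℝ} {a b : Fin r → ℤ} (h : toLex b < toLex a) :
    key w a < key w b ↔ ¬ 0 ≤ dot w (a - b) := by
  rw [key_lt_key, dot_sub, sub_nonneg, not_le]
  exact or_iff_left fun h' => h.not_gt h'.2

/-- The set of vectors of `U` on which `w` is nonnegative. -/
noncomputable def pat (U : Finset (Fin r → ℤ)) (w : Fin r → ℝ) : Finset (Fin r → ℤ) :=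
  {u ∈ U | 0 ≤ dot w u}

/-- The number of sign patterns on `U` realized by the inputs in `S`. -/
noncomputable def patCard (U : Finset (Fin r → ℤ)) (S : Set (Fin r → ℝ)) : ℕ :=
  (pat U '' S).ncard

lemma finite_image_pat (U : Finset (Fin r → ℤ)) (S : Set (Fin r → ℝ)) : (pat U '' S).Finite := by
  refine (U.powerset.finite_toSet).subset ?_
  rintro _ ⟨w, -, rfl⟩
  exact mem_coe.2 (mem_powerset.2 (filter_subset _ _))

lemma patCard_mono (U : Finset (Fin r → ℤ)) {S S' : Set (Fin r → ℝ)} (h : S ⊆ S') :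
    patCard U S ≤ patCard U S' :=
  Set.ncard_le_ncard (Set.image_mono h) (finite_image_pat U S')

lemma patCard_pos (U : Finset (Fin r → ℤ)) {S : Set (Fin r → ℝ)} (h : S.Nonempty) :
    0 < patCard U S :=
  (Set.ncard_pos (finite_image_pat U S)).2 (h.image _)

lemma patCard_empty (U : Finset (Fin r → ℤ)) : patCard U (∅ : Set (Fin r → ℝ)) = 0 := by
  simp [patCard]

lemma sum_choose_le (M r : ℕ) : ∑ i ∈ range (r + 1), M.choose i ≤ (M + 1) ^ r := by
  rw [add_pow]
  refine sum_le_sum fun i hi => ?_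
  rw [one_pow, mul_one]
  calc M.choose i ≤ M ^ i := Nat.choose_le_pow M i
    _ ≤ M ^ i * r.choose i :=
      Nat.le_mul_of_pos_right _ (Nat.choose_pos (Nat.lt_succ_iff.1 (mem_range.1 hi)))

/-- Sets shattered by homogeneous halfspaces of `ℝ^r` have at most `r` elements. -/
lemma card_le_of_forall_subset_exists_pat {s : Finset (Fin r → ℤ)}
    (h : ∀ t ⊆ s, ∃ w : Fin r → ℝ, ∀ a ∈ s, a ∈ t ↔ 0 ≤ dot w a) : s.card ≤ r := by
  classical
  by_contra! hr
  have hli : ¬ LinearIndependent ℝ (fun a : s => fun i => ((a.1 i : ℤ) : ℝ)) := by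
    intro hli
    have := hli.fintype_card_le_finrank
    simp at this
    omega
  obtain ⟨c, hc, j, hj⟩ := Fintype.not_linearIndependent_iff.1 hli
  have hnn : ∀ c : s → ℝ, (∑ a, c a • (fun i => ((a.1 i : ℤ) : ℝ))) = 0 → ∀ j, ¬ c j < 0 := by
    intro c hc j hj
    obtain ⟨w, hw⟩ := h (s.attach.filter (fun a => 0 ≤ c a) |>.image Subtype.val) (by
      intro x hx
      obtain ⟨a, -, rfl⟩ := mem_image.1 hx
      exact a.2)
    have hw' : ∀ a : s, 0 ≤ c a ↔ 0 ≤ dot w a.1 := by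
      intro a
      rw [← hw a a.2]
      simp
    have hsum : ∑ a : s, c a * dot w a.1 = 0 := by
      have : ∑ i, (∑ a, c a • (fun i => ((a.1 i : ℤ) : ℝ))) i * w i = 0 := by
        rw [hc]
        simp
      rw [← this]
      simp only [dot, Finset.sum_apply, Pi.smul_apply, smul_eq_mul, sum_mul, mul_sum]
      rw [sum_comm]
      simp only [mul_assoc]
    have hpos : 0 < ∑ a : s, c a * dot w a.1 := by
      refine sum_pos' (fun a _ => ?_) ⟨j, mem_univ _, ?_⟩
      · by_cases ha : 0 ≤ c a
        · exact mul_nonneg ha ((hw' a).1 ha)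
        · have h2 : ¬ 0 ≤ dot w a.1 := fun h => ha ((hw' a).2 h)
          exact mul_nonneg_of_nonpos_of_nonpos (not_le.1 ha).le (not_le.1 h2).le
      · have h2 : ¬ 0 ≤ dot w j.1 := fun h => hj.not_ge ((hw' j).2 h)
        exact mul_pos_of_neg_of_neg hj (not_le.1 h2)
    exact hpos.ne' hsum
  rcases lt_or_gt_of_ne hj with hj | hj
  · exact hnn c hc j hj
  · refine hnn (-c) ?_ j (by simpa using hj)
    simpa [sum_neg_distrib] using hc

lemma patCard_le (U : Finset (Fin r → ℤ)) (S : Set (Fin r → ℝ)) :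
    patCard U S ≤ (U.card + 1) ^ r := by
  classical
  let 𝒜 : Finset (Finset (Fin r → ℤ)) := U.powerset.filter fun t => ∃ w, pat U w = t
  have h1 : patCard U S ≤ 𝒜.card := by
    rw [patCard, ← Set.ncard_coe_finset]
    refine Set.ncard_le_ncard ?_ (finite_toSet _)
    rintro _ ⟨w, -, rfl⟩
    exact mem_coe.2 (mem_filter.2 ⟨mem_powerset.2 (filter_subset _ _), w, rfl⟩)
  have h2 : 𝒜.shatterer ⊆ (range (r + 1)).biUnion fun i => U.powersetCard i := by
    intro s hs
    rw [mem_shatterer] at hs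
    have hsU : s ⊆ U := by
      obtain ⟨u, hu, hsu⟩ := hs (Subset.refl s)
      have hu' : u ⊆ U := mem_powerset.1 (mem_filter.1 hu).1
      exact (inter_eq_left.1 hsu).trans hu'
    refine mem_biUnion.2 ⟨s.card, mem_range.2 (Nat.lt_succ_iff.2 ?_), mem_powersetCard.2 ⟨hsU, rfl⟩⟩
    refine card_le_of_forall_subset_exists_pat fun t ht => ?_
    obtain ⟨u, hu, hsu⟩ := hs ht
    obtain ⟨w, rfl⟩ := (mem_filter.1 hu).2
    refine ⟨w, fun a ha => ?_⟩
    rw [← hsu]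
    simp [pat, ha, hsU ha]
  calc patCard U S ≤ 𝒜.shatterer.card := h1.trans (card_le_card_shatterer 𝒜)
    _ ≤ _ := card_le_card h2
    _ ≤ ∑ i ∈ range (r + 1), (U.powersetCard i).card := card_biUnion_le
    _ = ∑ i ∈ range (r + 1), U.card.choose i := by simp
    _ ≤ _ := sum_choose_le _ _

/-- Integer vectors with entries in `{-2,…,2}`. -/
def Small (u : Fin r → ℤ) : Prop := ∀ i, u i ∈ ({-2, -1, 0, 1, 2} : Set ℤ)

/-- On `S`, the relation `R` between inputs and outputs is realized by a tree of depth at most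
`n` with small coefficients. -/
def Solvable {β : Type} (n : ℕ) (S : Set (Fin r → ℝ)) (R : (Fin r → ℝ) → β → Prop) : Prop :=
  ∃ t : LDT (Fin r) β, t.depth ≤ n ∧ t.SmallCoeffs ∧ ∀ w ∈ S, R w (t.eval w)

/-- On `S`, the predicate `p` is constant or decided by the sign of one vector of `U`. -/
def Decided (U : Finset (Fin r → ℤ)) (S : Set (Fin r → ℝ)) (p : (Fin r → ℝ) → Prop) : Prop :=
  (∃ u ∈ U, Small u ∧
    ((∀ w ∈ S, p w ↔ 0 ≤ dot w u) ∨ ∀ w ∈ S, p w ↔ ¬ 0 ≤ dot w u)) ∨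
  (∀ w ∈ S, p w) ∨ ∀ w ∈ S, ¬ p w

lemma Decided.mono {U : Finset (Fin r → ℤ)} {S S' : Set (Fin r → ℝ)} {p : (Fin r → ℝ) → Prop}
    (h : Decided U S p) (hS : S' ⊆ S) : Decided U S' p := by
  rcases h with ⟨u, hu, hs, h | h⟩ | h | h
  · exact Or.inl ⟨u, hu, hs, Or.inl fun w hw => h w (hS hw)⟩
  · exact Or.inl ⟨u, hu, hs, Or.inr fun w hw => h w (hS hw)⟩
  · exact Or.inr (Or.inl fun w hw => h w (hS hw))
  · exact Or.inr (Or.inr fun w hw => h w (hS hw))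

lemma Decided.patCard_add_le {U : Finset (Fin r → ℤ)} {S : Set (Fin r → ℝ)}
    {p : (Fin r → ℝ) → Prop} (h : Decided U S p) :
    patCard U {w ∈ S | p w} + patCard U {w ∈ S | ¬ p w} ≤ patCard U S := by
  have main : (∀ w ∈ S, ∀ w' ∈ S, pat U w = pat U w' → (p w ↔ p w')) →
      patCard U {w ∈ S | p w} + patCard U {w ∈ S | ¬ p w} ≤ patCard U S := by
    intro h
    have hd : Disjoint (pat U '' {w ∈ S | p w}) (pat U '' {w ∈ S | ¬ p w}) := by
      rw [Set.disjoint_left]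
      rintro _ ⟨w, hw, rfl⟩ ⟨w', hw', he⟩
      exact hw'.2 ((h w hw.1 w' hw'.1 he.symm).1 hw.2)
    rw [patCard, patCard,
      ← Set.ncard_union_eq hd (finite_image_pat U _) (finite_image_pat U _), ← Set.image_union]
    exact patCard_mono U (Set.union_subset (Set.sep_subset _ _) (Set.sep_subset _ _))
  apply main
  intro w hw w' hw' he
  rcases h with ⟨u, hu, -, h⟩ | h | h
  · have h1 : 0 ≤ dot w u ↔ 0 ≤ dot w' u := by
      have := congrArg (fun s => u ∈ s) he
      simpa [pat, hu] using this
    rcases h with h | h <;> rw [h w hw, h w' hw', h1]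
  · exact iff_of_true (h w hw) (h w' hw')
  · exact iff_of_false (h w hw) (h w' hw')

namespace Solvable

variable {β : Type} {n : ℕ} {S : Set (Fin r → ℝ)} {R : (Fin r → ℝ) → β → Prop}

lemma mono {n' : ℕ} (h : Solvable n S R) (hn : n ≤ n') : Solvable n' S R := by
  obtain ⟨t, h1, h2, h3⟩ := h
  exact ⟨t, h1.trans hn, h2, h3⟩

lemma of_leaf (b : β) (h : ∀ w ∈ S, R w b) : Solvable n S R :=
  ⟨leaf b, Nat.zero_le _, trivial, h⟩

lemma split {U : Finset (Fin r → ℤ)} {p : (Fin r → ℝ) → Prop} (hp : Decided U S p)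
    (h1 : Solvable n {w ∈ S | p w} R) (h2 : Solvable n {w ∈ S | ¬ p w} R) :
    Solvable (n + 1) S R := by
  rcases hp with ⟨u, -, hs, h⟩ | h | h
  · obtain ⟨t1, d1, s1, e1⟩ := h1
    obtain ⟨t2, d2, s2, e2⟩ := h2
    rcases h with h | h
    · refine ⟨node u 0 t1 t2, by simp [depth, d1, d2], ⟨hs, s1, s2⟩, fun w hw => ?_⟩
      by_cases hw' : 0 ≤ dot w u
      · have := e1 w ⟨hw, (h w hw).2 hw'⟩
        rw [dot] at hw'
        rwa [eval, if_pos hw']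
      · have := e2 w ⟨hw, fun hh => hw' ((h w hw).1 hh)⟩
        rw [dot] at hw'
        rwa [eval, if_neg hw']
    · refine ⟨node u 0 t2 t1, by simp [depth, d1, d2], ⟨hs, s2, s1⟩, fun w hw => ?_⟩
      by_cases hw' : 0 ≤ dot w u
      · have := e2 w ⟨hw, fun hh => (h w hw).1 hh hw'⟩
        rw [dot] at hw'
        rwa [eval, if_pos hw']
      · have := e1 w ⟨hw, (h w hw).2 hw'⟩
        rw [dot] at hw'
        rwa [eval, if_neg hw']
  · have : {w ∈ S | p w} = S := Set.sep_eq_self_iff_mem_true.2 h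
    rw [this] at h1
    exact h1.mono (Nat.le_succ n)
  · have : {w ∈ S | ¬ p w} = S := Set.sep_eq_self_iff_mem_true.2 h
    rw [this] at h2
    exact h2.mono (Nat.le_succ n)

lemma log_succ_le {x y : ℕ} (hx : 0 < x) (h : 2 * x ≤ y) : Nat.log 2 x + 1 ≤ Nat.log 2 y := by
  rw [← Nat.log_mul_base (by norm_num) hx.ne', mul_comm]
  exact Nat.log_mono_right h

/-- Weighted binary search for the value of `f`: the cost is paid for by the drop in the number
of sign patterns that remain possible. -/
lemma search [Nonempty β] {U : Finset (Fin r → ℤ)} {f : (Fin r → ℝ) → ℕ}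
    (M : ℕ) (hM : ∀ w, f w ≤ M)
    (hq : ∀ j, Decided U S fun w => j ≤ f w)
    (hk : ∀ j, ∀ S' ⊆ S, (∀ w ∈ S', f w = j) →
      Solvable (n + 2 * Nat.log 2 (patCard U S')) S' R) :
    Solvable (n + 2 + 2 * Nat.log 2 (patCard U S)) S R := by
  induction hN : patCard U S using Nat.strong_induction_on generalizing S with
  | _ N ih =>
  subst hN
  rcases S.eq_empty_or_nonempty with rfl | hS
  · exact of_leaf (Classical.arbitrary β) (by simp)
  have hpos := patCard_pos U hS
  obtain ⟨j, hj, hj'⟩ : ∃ j, patCard U S ≤ 2 * patCard U {w ∈ S | j ≤ f w} ∧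
      ¬ patCard U S ≤ 2 * patCard U {w ∈ S | j + 1 ≤ f w} := by
    by_contra! hcon
    have hall : ∀ j, patCard U S ≤ 2 * patCard U {w ∈ S | j ≤ f w} := by
      intro j
      induction j with
      | zero => simp only [Nat.zero_le, and_true, Set.ofPred_mem_eq]; omega
      | succ j ihj => exact hcon j ihj
    have h := hall (M + 1)
    have he : {w ∈ S | M + 1 ≤ f w} = ∅ := by
      ext w
      have := hM w
      simp only [Set.mem_ofPred_eq, Set.mem_empty_iff_false, iff_false, not_and]
      omega
    rw [he, patCard_empty] at h
    omega
  have hadd := (hq j).patCard_add_le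
  have hrec : ∀ S' ⊆ S, 2 * patCard U S' ≤ patCard U S →
      Solvable (n + 2 * Nat.log 2 (patCard U S)) S' R := by
    intro S' hS' hc
    rcases S'.eq_empty_or_nonempty with rfl | hne
    · exact of_leaf (Classical.arbitrary β) (by simp)
    have hp' := patCard_pos U hne
    have := log_succ_le hp' hc
    refine (ih _ (by omega) (fun j => (hq j).mono hS')
      (fun j S'' h'' => hk j S'' (h''.trans hS')) rfl).mono ?_
    omega
  have h2 : Solvable (n + 2 * Nat.log 2 (patCard U S) + 1) {w ∈ S | j ≤ f w} R := by
    refine split ((hq (j + 1)).mono (Set.sep_subset _ _)) ?_ ?_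
    · have he : {w ∈ {w ∈ S | j ≤ f w} | j + 1 ≤ f w} = {w ∈ S | j + 1 ≤ f w} := by
        ext w
        simp only [Set.mem_ofPred_eq]
        constructor
        · exact fun h => ⟨h.1.1, h.2⟩
        · exact fun h => ⟨⟨h.1, by omega⟩, h.2⟩
      rw [he]
      exact hrec _ (Set.sep_subset _ _) (by omega)
    · have hsub : {w ∈ {w ∈ S | j ≤ f w} | ¬ j + 1 ≤ f w} ⊆ S :=
        (Set.sep_subset _ _).trans (Set.sep_subset _ _)
      refine (hk j _ hsub ?_).mono ?_
      · rintro w ⟨⟨-, h1⟩, h2⟩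
        omega
      · have := Nat.log_mono_right (b := 2) (patCard_mono U hsub)
        omega
  refine (split (hq j) h2 ((hrec _ (Set.sep_subset _ _) ?_).mono (Nat.le_succ _))).mono ?_
  · omega
  · omega

end Solvable

lemma exists_strictMono_seq {α γ : Type*} [LinearOrder γ] (P : Finset α) {k : α → γ}
    (hk : Function.Injective k) {d : ℕ} (hd : d < P.card) :
    ∃ a : ℕ → α, (∀ i ≤ d, a i ∈ P) ∧ ∀ i j, i < j → j ≤ d → k (a i) < k (a j) := by
  classical
  have hc : (P.image k).card = P.card := card_image_of_injective P hk
  let e := (P.image k).orderEmbOfFin hc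
  have hex : ∀ i : Fin P.card, ∃ x ∈ P, k x = e i := fun i =>
    mem_image.1 (orderEmbOfFin_mem (P.image k) hc i)
  choose b hbP hb using hex
  have hlt : ∀ i, i ≤ d → i < P.card := fun i hi => hi.trans_lt hd
  refine ⟨fun i => if h : i < P.card then b ⟨i, h⟩ else b ⟨0, by omega⟩, ?_, ?_⟩
  · intro i hi
    simp only [dif_pos (hlt i hi)]
    exact hbP _
  · intro i j hij hj
    simp only [dif_pos (hlt i (hij.le.trans hj)), dif_pos (hlt j hj), hb]
    exact e.strictMono hij

lemma exists_card_filter_le_eq {α γ : Type*} [LinearOrder γ] (A : Finset α) {k : α → γ}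
    (hk : Function.Injective k) {j : ℕ} (hj : 0 < j) (hjA : j ≤ A.card) :
    ∃ x ∈ A, #{a ∈ A | k a ≤ k x} = j := by
  classical
  induction hn : A.card generalizing A with
  | zero => omega
  | succ n ih =>
    obtain ⟨m, hm, hmax⟩ := A.exists_max_image k (card_pos.1 (by omega))
    rcases hjA.eq_or_lt with h | h
    · exact ⟨m, hm, by rw [filter_true_of_mem hmax, h]⟩
    · have hc := card_erase_of_mem hm
      obtain ⟨x, hx, hxj⟩ := ih (A.erase m) (by omega) (by omega)
      refine ⟨x, mem_of_mem_erase hx, ?_⟩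
      rw [← hxj]
      congr 1
      ext a
      simp only [mem_filter, mem_erase]
      refine ⟨fun ha => ⟨⟨?_, ha.1⟩, ha.2⟩, fun ha => ⟨ha.1.2, ha.2⟩⟩
      rintro rfl
      exact (mem_erase.1 hx).1 (hk (le_antisymm (hmax x (mem_of_mem_erase hx)) ha.2))

/-- `w` and `w'` order the vectors of `A` in the same way. -/
def SameOrder (A : Finset (Fin r → ℤ)) (w w' : Fin r → ℝ) : Prop :=
  ∀ a ∈ A, ∀ b ∈ A, key w a < key w b ↔ key w' a < key w' b

lemma SameOrder.le_iff {A : Finset (Fin r → ℤ)} {w w' : Fin r → ℝ} (h : SameOrder A w w')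
    {a b : Fin r → ℤ} (ha : a ∈ A) (hb : b ∈ A) : key w a ≤ key w b ↔ key w' a ≤ key w' b := by
  rw [← not_lt, ← not_lt, h b hb a ha]

lemma SameOrder.trans {A : Finset (Fin r → ℤ)} {w w' w'' : Fin r → ℝ} (h : SameOrder A w w')
    (h' : SameOrder A w' w'') : SameOrder A w w'' :=
  fun a ha b hb => (h a ha b hb).trans (h' a ha b hb)

lemma SameOrder.mono {A B : Finset (Fin r → ℤ)} {w w' : Fin r → ℝ} (h : SameOrder A w w')
    (hB : B ⊆ A) : SameOrder B w w' := fun a ha b hb => h a (hB ha) b (hB hb)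

/-- The number of elements of `A` that `w` places below `h`. -/
noncomputable def rank (A : Finset (Fin r → ℤ)) (h : Fin r → ℤ) (w : Fin r → ℝ) : ℕ :=
  #{a ∈ A | key w a < key w h}

lemma SameOrder.insert {A : Finset (Fin r → ℤ)} {w w' : Fin r → ℝ} (hA : SameOrder A w w')
    {h : Fin r → ℤ} (hr : rank A h w = rank A h w') (hh : h ∉ A) :
    SameOrder (insert h A) w w' := by
  have hset : ({a ∈ A | key w a < key w h} : Finset _) = {a ∈ A | key w' a < key w' h} := by
    by_cases hsub : ({a ∈ A | key w a < key w h} : Finset _) ⊆ {a ∈ A | key w' a < key w' h}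
    · exact eq_of_subset_of_card_le hsub hr.ge
    · refine (eq_of_subset_of_card_le ?_ hr.le).symm
      obtain ⟨a, ha, ha'⟩ := not_subset.1 hsub
      rw [mem_filter] at ha ha'
      have h1 : key w' h ≤ key w' a := not_lt.1 fun hlt => ha' ⟨ha.1, hlt⟩
      intro b hb
      rw [mem_filter] at hb ⊢
      exact ⟨hb.1, ((hA b hb.1 a ha.1).2 (hb.2.trans_le h1)).trans ha.2⟩
  have hlt : ∀ a ∈ A, key w a < key w h ↔ key w' a < key w' h := by
    intro a ha
    have := congrArg (fun s => a ∈ s) hset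
    simpa [ha] using this
  have hgt : ∀ a ∈ A, key w h < key w a ↔ key w' h < key w' a := by
    intro a ha
    have hne : h ≠ a := fun he => hh (he ▸ ha)
    rw [← not_iff_not, not_lt, not_lt, ((key_injective w).ne hne.symm).le_iff_lt,
      ((key_injective w').ne hne.symm).le_iff_lt]
    exact hlt a ha
  intro a ha b hb
  rcases mem_insert.1 ha with rfl | ha' <;> rcases mem_insert.1 hb with rfl | hb'
  · simp
  · exact hgt b hb'
  · exact hlt a ha'
  · exact hA a ha' b hb'

/-- `U` contains all differences of elements of `E`, and these have entries in `{-2,…,2}`. -/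
def ContainsDiffs (U E : Finset (Fin r → ℤ)) : Prop :=
  ∀ a ∈ E, ∀ b ∈ E, b - a ∈ U ∧ Small (b - a)

lemma decided_key_lt {U E : Finset (Fin r → ℤ)} (hU : ContainsDiffs U E) {a b : Fin r → ℤ}
    (ha : a ∈ E) (hb : b ∈ E) (S : Set (Fin r → ℝ)) :
    Decided U S fun w => key w a < key w b := by
  rcases lt_trichotomy (toLex a) (toLex b) with h | h | h
  · exact Or.inl ⟨b - a, (hU a ha b hb).1, (hU a ha b hb).2,
      Or.inl fun w _ => key_lt_key_of_lt h⟩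
  · have : a = b := h
    subst this
    exact Or.inr (Or.inr fun w _ => lt_irrefl _)
  · exact Or.inl ⟨a - b, (hU b hb a ha).1, (hU b hb a ha).2,
      Or.inr fun w _ => key_lt_key_of_gt h⟩

lemma Decided.congr {U : Finset (Fin r → ℤ)} {S : Set (Fin r → ℝ)} {p q : (Fin r → ℝ) → Prop}
    (h : Decided U S p) (hpq : ∀ w ∈ S, q w ↔ p w) : Decided U S q := by
  rcases h with ⟨u, hu, hs, h | h⟩ | h | h
  · exact Or.inl ⟨u, hu, hs, Or.inl fun w hw => (hpq w hw).trans (h w hw)⟩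
  · exact Or.inl ⟨u, hu, hs, Or.inr fun w hw => (hpq w hw).trans (h w hw)⟩
  · exact Or.inr (Or.inl fun w hw => (hpq w hw).2 (h w hw))
  · exact Or.inr (Or.inr fun w hw hq => h w hw ((hpq w hw).1 hq))

lemma decided_le_rank {U E A : Finset (Fin r → ℤ)} (hU : ContainsDiffs U E) (hA : A ⊆ E)
    {h : Fin r → ℤ} (hh : h ∈ E) {S : Set (Fin r → ℝ)}
    (hS : ∀ w ∈ S, ∀ w' ∈ S, SameOrder A w w') (j : ℕ) :
    Decided U S fun w => j ≤ rank A h w := by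
  rcases S.eq_empty_or_nonempty with rfl | ⟨w₀, hw₀⟩
  · exact Or.inr (Or.inl (by simp))
  rcases Nat.eq_zero_or_pos j with rfl | hj
  · exact Or.inr (Or.inl (by simp))
  by_cases hjA : j ≤ A.card
  swap
  · refine Or.inr (Or.inr fun w _ hw => hjA (hw.trans (card_filter_le _ _)))
  obtain ⟨x, hx, hxj⟩ := exists_card_filter_le_eq A (key_injective w₀) hj hjA
  refine (decided_key_lt hU (hA hx) hh S).congr fun w hw => ?_
  have hxj' : #{a ∈ A | key w a ≤ key w x} = j := by
    rw [← hxj]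
    congr 1
    exact filter_congr fun a ha => (hS w hw w₀ hw₀).le_iff ha hx
  constructor
  · intro hle
    by_contra hlt
    rw [not_lt] at hlt
    have hss : ({a ∈ A | key w a < key w h} : Finset _) ⊂ {a ∈ A | key w a ≤ key w x} := by
      refine (ssubset_iff_of_subset fun a ha => ?_).2 ⟨x, ?_, ?_⟩
      · rw [mem_filter] at ha ⊢
        exact ⟨ha.1, ha.2.le.trans hlt⟩
      · simp [hx]
      · simp [hlt]
    have := card_lt_card hss
    rw [rank] at hle
    omega
  · intro hlt
    rw [← hxj']
    refine card_le_card fun a ha => ?_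
    rw [mem_filter] at ha ⊢
    exact ⟨ha.1, ha.2.trans_lt hlt⟩

/-- Fredman's sorting bound: the order of `A ∪ l` is found, from the order of `A`, by binary
insertion weighted by the number of sign patterns that remain possible. -/
lemma Solvable.sort {β : Type} [Nonempty β] {n : ℕ} {R : (Fin r → ℝ) → β → Prop}
    {U E : Finset (Fin r → ℤ)} (hU : ContainsDiffs U E) (l A : Finset (Fin r → ℤ))
    (hl : l ⊆ E) (hA : A ⊆ E) (S : Set (Fin r → ℝ))
    (hS : ∀ w ∈ S, ∀ w' ∈ S, SameOrder A w w')
    (hk : ∀ S' ⊆ S, (∀ w ∈ S', ∀ w' ∈ S', SameOrder (A ∪ l) w w') → Solvable n S' R) :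
    Solvable (n + 2 * l.card + 2 * Nat.log 2 (patCard U S)) S R := by
  induction l using Finset.induction_on generalizing A S with
  | empty =>
    refine (hk S subset_rfl ?_).mono (by omega)
    simpa using hS
  | insert h l hhl ih =>
    rw [insert_subset_iff] at hl
    rw [card_insert_of_notMem hhl]
    by_cases hhA : h ∈ A
    · refine (ih A hl.2 hA S hS fun S' hS' hc => hk S' hS' ?_).mono (by omega)
      rwa [union_insert, insert_eq_of_mem (mem_union_left _ hhA)]
    · refine (search (n := n + 2 * l.card) A.card (fun w => card_filter_le _ _)
        (decided_le_rank hU hA hl.1 hS) fun j S' hS' hj => ?_).mono (by omega)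
      refine ih (insert h A) hl.2 (insert_subset hl.1 hA) S' ?_ ?_
      · intro w hw w' hw'
        exact (hS w (hS' hw) w' (hS' hw')).insert ((hj w hw).trans (hj w' hw').symm) hhA
      · intro S'' hS'' hc
        refine hk S'' (hS''.trans hS') ?_
        rwa [union_insert, ← insert_union]

lemma exists_eq_add_sum_of_sum_eq {V : Type*} [AddCommGroup V] (x : ℕ → V) {d : ℕ}
    {A B : Finset ℕ} (hA : A ⊆ range d) (hB : B ⊆ range d) (hne : A ≠ B)
    (hs : ∑ i ∈ A, (x (i + 1) - x i) = ∑ i ∈ B, (x (i + 1) - x i)) :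
    ∃ p < d, ∃ c : ℕ → ℤ, (∀ i, 0 ≤ c i) ∧
      x (p + 1) = x 0 + ∑ i ∈ range p, c i • (x (i + 1) - x i) := by
  classical
  have hne' : (symmDiff A B).Nonempty := by
    rw [nonempty_iff_ne_empty]
    exact fun h => hne (symmDiff_eq_bot.1 h)
  obtain ⟨p, hp, hmax⟩ := (symmDiff A B).exists_max_image id hne'
  wlog hpB : p ∈ B ∧ p ∉ A generalizing A B
  · refine this hB hA hne.symm hs.symm ?_ ?_ ?_ ?_
    · rwa [symmDiff_comm]
    · rwa [symmDiff_comm]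
    · rwa [symmDiff_comm]
    · rcases mem_symmDiff.1 hp with h | h
      · exact h
      · exact absurd h hpB
  have hpd : p < d := mem_range.1 (hB hpB.1)
  have hsplit : ∀ C ⊆ range d, ∑ i ∈ C, (x (i + 1) - x i)
      = ∑ i ∈ range d, (if i ∈ C then (1 : ℤ) else 0) • (x (i + 1) - x i) := by
    intro C hC
    rw [← sum_subset hC]
    · exact sum_congr rfl fun i hi => by simp [hi]
    · intro i _ hi
      simp [hi]
  let α : ℕ → ℤ := fun i => (if i ∈ A then (1 : ℤ) else 0) - if i ∈ B then (1 : ℤ) else 0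
  have hα0 : ∑ i ∈ range d, α i • (x (i + 1) - x i) = 0 := by
    simp only [α, sub_smul]
    rw [sum_sub_distrib, ← hsplit A hA, ← hsplit B hB, hs, sub_self]
  have hαbig : ∀ i, p < i → α i = 0 := by
    intro i hi
    have hi' : i ∉ symmDiff A B := fun h => (hmax i h).not_gt hi
    rw [mem_symmDiff] at hi'
    have hiff : i ∈ A ↔ i ∈ B := by tauto
    simp only [α, hiff, sub_self]
  have hαp : α p = -1 := by simp [α, hpB.1, hpB.2]
  have hsum : ∑ i ∈ range p, α i • (x (i + 1) - x i) = x (p + 1) - x p := by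
    have h1 : ∑ i ∈ range (p + 1), α i • (x (i + 1) - x i) = 0 := by
      rw [← hα0]
      refine sum_subset (range_subset_range.2 hpd) fun i _ hi => ?_
      rw [hαbig i (by rw [mem_range] at hi; omega), zero_smul]
    rw [sum_range_succ, hαp, neg_one_smul] at h1
    rwa [← sub_eq_zero, sub_eq_add_neg]
  refine ⟨p, hpd, fun i => 1 + α i, fun i => ?_, ?_⟩
  · simp only [α]
    split_ifs <;> norm_num
  · simp only [add_smul, one_smul]
    rw [sum_add_distrib, hsum, sum_range_sub]
    abel

/-- A long enough sequence of vectors with entries in `{-1,0,1}` has a member that lies in the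
cone spanned by the first one and the differences between consecutive earlier ones. -/
lemma exists_eq_add_sum {d : ℕ} (hd : (4 * d + 1) ^ r < 2 ^ d) (x : ℕ → Fin r → ℤ)
    (hx : ∀ i ≤ d, ∀ k, |x i k| ≤ 1) :
    ∃ p < d, ∃ c : ℕ → ℤ, (∀ i, 0 ≤ c i) ∧
      x (p + 1) = x 0 + ∑ i ∈ range p, c i • (x (i + 1) - x i) := by
  classical
  let T : Finset (Fin r → ℤ) := Fintype.piFinset fun _ => Icc (-(2 * d : ℤ)) (2 * d)
  have hT : T.card < (range d).powerset.card := by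
    rw [Fintype.card_piFinset_const, Int.card_Icc, card_powerset, card_range]
    convert hd using 2
    omega
  have hmaps : ∀ A ∈ (range d).powerset, ∑ i ∈ A, (x (i + 1) - x i) ∈ T := by
    intro A hA
    rw [mem_powerset] at hA
    rw [Fintype.mem_piFinset]
    intro k
    rw [Finset.sum_apply, mem_Icc, ← abs_le]
    calc |∑ i ∈ A, (x (i + 1) - x i) k| ≤ ∑ i ∈ A, |(x (i + 1) - x i) k| := abs_sum_le_sum_abs _ _
      _ ≤ ∑ i ∈ A, (2 : ℤ) := by
        refine sum_le_sum fun i hi => ?_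
        have hi' := mem_range.1 (hA hi)
        have h1 := abs_le.1 (hx (i + 1) hi' k)
        have h2 := abs_le.1 (hx i hi'.le k)
        rw [Pi.sub_apply, abs_le]
        omega
      _ ≤ 2 * d := by
        rw [sum_const, nsmul_eq_mul]
        have := card_le_card hA
        rw [card_range] at this
        omega
  obtain ⟨A, hA, B, hB, hne, hs⟩ := exists_ne_map_eq_of_card_lt_of_maps_to hT hmaps
  exact exists_eq_add_sum_of_sum_eq x (mem_powerset.1 hA) (mem_powerset.1 hB) hne hs

/-- `w` is not orthogonal to any sign vector. -/
def Generic (w : Fin r → ℝ) : Prop :=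
  ∀ a : Fin r → ℤ, (∀ i, a i = 1 ∨ a i = -1) → dot w a ≠ 0

lemma zero_lt_dot_iff {w : Fin r → ℝ} (hw : Generic w) {a : Fin r → ℤ}
    (ha : ∀ i, a i = 1 ∨ a i = -1) : 0 < dot w a ↔ key w 0 < key w a := by
  rw [key_lt_key, dot_zero]
  exact ⟨Or.inl, fun h => h.elim id fun h' => absurd h'.1.symm (hw a ha)⟩

lemma dot_lt_zero_iff {w : Fin r → ℝ} (hw : Generic w) {a : Fin r → ℤ}
    (ha : ∀ i, a i = 1 ∨ a i = -1) : dot w a < 0 ↔ key w a < key w 0 := by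
  rw [key_lt_key, dot_zero]
  exact ⟨Or.inl, fun h => h.elim id fun h' => absurd h'.1 (hw a ha)⟩

section Inference

variable {α : Type} {v : α → Fin r → ℤ}

/-- The vectors whose relative order is learned when the sample `s` is sorted. -/
def known (v : α → Fin r → ℤ) (s : Finset α) : Finset (Fin r → ℤ) := insert 0 (s.image v)

lemma mem_known {s : Finset α} {h : α} (hh : h ∈ s) : v h ∈ known v s :=
  mem_insert_of_mem (mem_image_of_mem v hh)

lemma zero_mem_known (s : Finset α) : (0 : Fin r → ℤ) ∈ known v s := mem_insert_self _ _

lemma known_mono {s t : Finset α} (h : s ⊆ t) : known v s ⊆ known v t :=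
  insert_subset_insert _ (image_subset_image h)

/-- The sign of `v h` at `w` is determined by the order of `known v s` at `w`. -/
def Inferred (v : α → Fin r → ℤ) (s : Finset α) (w : Fin r → ℝ) (h : α) : Prop :=
  ∀ w', Generic w' → SameOrder (known v s) w w' → (0 < dot w (v h) ↔ 0 < dot w' (v h))

lemma Inferred.mono {s t : Finset α} {w : Fin r → ℝ} {h : α} (hs : Inferred v s w h)
    (hst : s ⊆ t) : Inferred v t w h :=
  fun w' hw' ho => hs w' hw' (ho.mono (known_mono hst))

lemma Inferred.congr {s : Finset α} {w w' : Fin r → ℝ} {h : α} (hs : Inferred v s w h)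
    (hw' : Generic w') (ho : SameOrder (known v s) w w') : Inferred v s w' h :=
  fun w'' hw'' ho' => (hs w' hw' ho).symm.trans (hs w'' hw'' (ho.trans ho'))

lemma inferred_of_mem (hv : ∀ a i, v a i = 1 ∨ v a i = -1) {s : Finset α} {w : Fin r → ℝ}
    (hw : Generic w) {h : α} (hh : h ∈ s) : Inferred v s w h := by
  intro w' hw' ho
  rw [zero_lt_dot_iff hw (hv h), zero_lt_dot_iff hw' (hv h)]
  exact ho _ (zero_mem_known s) _ (mem_known hh)

/-- The inference dimension of sign vectors with respect to comparisons. -/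
lemma exists_inferred (hv : ∀ a i, v a i = 1 ∨ v a i = -1) (hinj : Function.Injective v)
    [DecidableEq α] {d : ℕ} (hd : (4 * d + 1) ^ r < 2 ^ d) {w : Fin r → ℝ} (hw : Generic w)
    (B : Finset α) (hB : 2 * d < B.card) : ∃ h ∈ B, Inferred v (B.erase h) w h := by
  classical
  have habs : ∀ a k, |v a k| ≤ 1 := by
    intro a k
    rcases hv a k with h | h <;> simp [h]
  have hcard := card_filter_add_card_filter_not (s := B) (fun h => 0 < dot w (v h))
  have hlin : ∀ (x : ℕ → α) (p : ℕ) (c : ℕ → ℤ),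
      v (x (p + 1)) = v (x 0) + ∑ i ∈ range p, c i • (v (x (i + 1)) - v (x i)) →
      ∀ w' : Fin r → ℝ, dot w' (v (x (p + 1))) = dot w' (v (x 0)) +
        ∑ i ∈ range p, (c i : ℝ) * (dot w' (v (x (i + 1))) - dot w' (v (x i))) := by
    intro x p c h w'
    rw [h, dot_add, dot_sum]
    simp only [dot_smul, dot_sub]
  by_cases hP : d < #{h ∈ B | 0 < dot w (v h)}
  · obtain ⟨x, hx, hlt⟩ := exists_strictMono_seq _ (k := fun a => key w (v a))
      ((key_injective w).comp hinj) hP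
    obtain ⟨p, hp, c, hc, he⟩ := exists_eq_add_sum hd (fun i => v (x i)) fun i _ k => habs _ k
    have hxB : ∀ i ≤ d, x i ∈ B := fun i hi => (mem_filter.1 (hx i hi)).1
    have hpos : ∀ i ≤ d, 0 < dot w (v (x i)) := fun i hi => (mem_filter.1 (hx i hi)).2
    have hmem : ∀ i ≤ p, x i ∈ B.erase (x (p + 1)) := fun i hi =>
      mem_erase.2 ⟨fun h => (hlt i (p + 1) (by omega) hp).ne (by rw [h]), hxB i (by omega)⟩
    refine ⟨x (p + 1), hxB _ hp, fun w' hw' ho => iff_of_true (hpos _ hp) ?_⟩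
    rw [hlin x p c he w']
    refine add_pos_of_pos_of_nonneg ?_ (sum_nonneg fun i hi => ?_)
    · rw [zero_lt_dot_iff hw' (hv _),
        ← ho _ (zero_mem_known _) _ (mem_known (hmem 0 (Nat.zero_le p))),
        ← zero_lt_dot_iff hw (hv _)]
      exact hpos 0 (Nat.zero_le d)
    · have hi := mem_range.1 hi
      refine mul_nonneg (by exact_mod_cast hc i) (sub_nonneg.2 (dot_le_of_key_lt ?_))
      rw [← ho _ (mem_known (hmem i hi.le)) _ (mem_known (hmem (i + 1) hi))]
      exact hlt i (i + 1) (Nat.lt_succ_self i) (by omega)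
  · have hN : d < #{h ∈ B | ¬ 0 < dot w (v h)} := by omega
    obtain ⟨x, hx, hlt⟩ := exists_strictMono_seq _
      (k := fun a => OrderDual.toDual (key w (v a)))
      (OrderDual.toDual.injective.comp ((key_injective w).comp hinj)) hN
    obtain ⟨p, hp, c, hc, he⟩ := exists_eq_add_sum hd (fun i => v (x i)) fun i _ k => habs _ k
    have hxB : ∀ i ≤ d, x i ∈ B := fun i hi => (mem_filter.1 (hx i hi)).1
    have hneg : ∀ i ≤ d, ¬ 0 < dot w (v (x i)) := fun i hi => (mem_filter.1 (hx i hi)).2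
    have hmem : ∀ i ≤ p, x i ∈ B.erase (x (p + 1)) := fun i hi =>
      mem_erase.2 ⟨fun h => (hlt i (p + 1) (by omega) hp).ne (by rw [h]), hxB i (by omega)⟩
    refine ⟨x (p + 1), hxB _ hp, fun w' hw' ho => iff_of_false (hneg _ hp) ?_⟩
    rw [hlin x p c he w', not_lt]
    refine add_nonpos ?_ (sum_nonpos fun i hi => ?_)
    · refine le_of_lt ?_
      rw [dot_lt_zero_iff hw' (hv _),
        ← ho _ (mem_known (hmem 0 (Nat.zero_le p))) _ (zero_mem_known _),
        ← dot_lt_zero_iff hw (hv _)]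
      exact lt_of_le_of_ne (not_lt.1 (hneg 0 (Nat.zero_le d))) (hw _ (hv _))
    · have hi := mem_range.1 hi
      refine mul_nonpos_of_nonneg_of_nonpos (by exact_mod_cast hc i)
        (sub_nonpos.2 (dot_le_of_key_lt ?_))
      rw [← ho _ (mem_known (hmem (i + 1) hi)) _ (mem_known (hmem i hi.le))]
      exact hlt i (i + 1) (Nat.lt_succ_self i) (by omega)

open Classical in
/-- The elements of `H` whose sign at `w` is not inferred from the sample `s`. -/
noncomputable def unresolved (v : α → Fin r → ℤ) (w : Fin r → ℝ) (s H : Finset α) : Finset α :=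
  {h ∈ H | ¬ Inferred v s w h}

lemma mem_unresolved {w : Fin r → ℝ} {s H : Finset α} {h : α} :
    h ∈ unresolved v w s H ↔ h ∈ H ∧ ¬ Inferred v s w h := by
  simp [unresolved]

/-- A random sample of size `4 * d - 1` resolves at least half of the elements on average. -/
lemma two_mul_sum_card_unresolved_le (hv : ∀ a i, v a i = 1 ∨ v a i = -1)
    (hinj : Function.Injective v) {d : ℕ} (hd : (4 * d + 1) ^ r < 2 ^ d) {m : ℕ}
    (hm : m + 1 = 4 * d) {w : Fin r → ℝ} (hw : Generic w) (H : Finset α) :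
    2 * ∑ s ∈ H.powersetCard (min m H.card), (unresolved v w s H).card
      ≤ (H.powersetCard (min m H.card)).card * H.card := by
  classical
  rcases le_or_gt H.card m with hHm | hHm
  · rw [min_eq_right hHm, powersetCard_self, sum_singleton]
    have : unresolved v w H H = ∅ := by
      ext h
      simp only [mem_unresolved, notMem_empty, iff_false, not_and, not_not]
      exact inferred_of_mem hv hw
    simp [this]
  rw [min_eq_left hHm.le]
  have hstep : ∑ s ∈ H.powersetCard m, (unresolved v w s H).card
      ≤ ∑ u ∈ H.powersetCard (m + 1), #{h ∈ u | ¬ Inferred v (u.erase h) w h} := by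
    rw [← card_sigma, ← card_sigma]
    refine card_le_card_of_injOn (fun q => ⟨insert q.2 q.1, q.2⟩) ?_ ?_
    · rintro ⟨s, h⟩ hq
      rw [mem_coe, mem_sigma, mem_powersetCard, mem_unresolved] at hq
      obtain ⟨⟨hsH, hsm⟩, hh, hni⟩ := hq
      have hhs : h ∉ s := fun hhs => hni (inferred_of_mem hv hw hhs)
      simp only [mem_coe, mem_sigma, mem_powersetCard, mem_filter]
      refine ⟨⟨insert_subset hh hsH, ?_⟩, mem_insert_self _ _, ?_⟩
      · rw [card_insert_of_notMem hhs, hsm]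
      · rwa [erase_insert hhs]
    · rintro ⟨s, h⟩ hq ⟨s', h'⟩ hq' he
      rw [mem_coe, mem_sigma, mem_unresolved] at hq hq'
      have hhs : h ∉ s := fun hhs => hq.2.2 (inferred_of_mem hv hw hhs)
      have hhs' : h' ∉ s' := fun hhs => hq'.2.2 (inferred_of_mem hv hw hhs)
      simp only [Sigma.mk.injEq, heq_eq_eq] at he hhs hhs' ⊢
      obtain ⟨h1, rfl⟩ := he
      refine ⟨?_, rfl⟩
      rw [← erase_insert hhs, h1, erase_insert hhs']
  have hle : ∀ u : Finset α, #{h ∈ u | ¬ Inferred v (u.erase h) w h} ≤ 2 * d := by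
    intro u
    by_contra! hcon
    obtain ⟨h, hh, hi⟩ := exists_inferred hv hinj hd hw _ hcon
    refine (mem_filter.1 hh).2 (hi.mono ?_)
    exact erase_subset_erase _ (filter_subset _ _)
  have hsum := hstep.trans (sum_le_card_nsmul _ _ (2 * d) fun u _ => hle u)
  rw [card_powersetCard, smul_eq_mul] at hsum
  rw [card_powersetCard]
  calc 2 * ∑ s ∈ H.powersetCard m, (unresolved v w s H).card
      ≤ 2 * (H.card.choose (m + 1) * (2 * d)) := Nat.mul_le_mul_left 2 hsum
    _ = H.card.choose (m + 1) * (m + 1) := by rw [hm]; ring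
    _ = H.card.choose m * (H.card - m) := Nat.choose_succ_right_eq _ _
    _ ≤ H.card.choose m * H.card := Nat.mul_le_mul_left _ (Nat.sub_le _ _)

/-- The elements left unresolved after sampling rounds with the sampling rules in a list. -/
noncomputable def remaining (v : α → Fin r → ℤ) (w : Fin r → ℝ) :
    List (Finset α → Finset α) → Finset α → Finset α
  | [], H => H
  | g :: gs, H => remaining v w gs (unresolved v w (g H) H)

/-- The truth table of the threshold function with weights `w`. -/
noncomputable def table (v : α → Fin r → ℤ) (w : Fin r → ℝ) : α → ℤ :=
  fun a => if 0 < dot w (v a) then 1 else -1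

lemma card_known_le {s : Finset α} : (known v s).card ≤ s.card + 1 :=
  (card_insert_le _ _).trans (Nat.succ_le_succ card_image_le)

lemma exists_containsDiffs (hv : ∀ a i, v a i = 1 ∨ v a i = -1) (s : Finset α) :
    ∃ U : Finset (Fin r → ℤ), U.card ≤ (s.card + 1) ^ 2 ∧ ContainsDiffs U (known v s) := by
  classical
  refine ⟨(known v s ×ˢ known v s).image fun q => q.2 - q.1, ?_, fun a ha b hb => ⟨?_, ?_⟩⟩
  · refine card_image_le.trans ?_
    rw [card_product, sq]
    exact Nat.mul_le_mul card_known_le card_known_le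
  · exact mem_image.2 ⟨(a, b), mem_product.2 ⟨ha, hb⟩, rfl⟩
  · have hent : ∀ c ∈ known v s, ∀ i, c i = 0 ∨ c i = 1 ∨ c i = -1 := by
      intro c hc i
      rcases mem_insert.1 hc with rfl | hc
      · exact Or.inl rfl
      · obtain ⟨x, -, rfl⟩ := mem_image.1 hc
        exact Or.inr (hv x i)
    intro i
    rw [Pi.sub_apply]
    rcases hent a ha i with h | h | h <;> rcases hent b hb i with h' | h' | h' <;>
      simp [h, h']

/-- For fixed sampling rules, one tree outputs the truth table whenever nothing is left
unresolved, and `none` or the truth table otherwise. -/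
lemma solvable_rounds (hv : ∀ a i, v a i = 1 ∨ v a i = -1) {m L : ℕ}
    (hL : ∀ U : Finset (Fin r → ℤ), U.card ≤ (m + 1) ^ 2 → ∀ S, Nat.log 2 (patCard U S) ≤ L)
    (gs : List (Finset α → Finset α)) (hgs : ∀ g ∈ gs, ∀ H, (g H).card ≤ m)
    (H : Finset α) (S : Set (Fin r → ℝ))
    (hS : ∀ h ∉ H, ∀ w ∈ S, ∀ w' ∈ S, Generic w → Generic w' →
      (0 < dot w (v h) ↔ 0 < dot w' (v h))) :
    Solvable (gs.length * (2 * (m + 1) + 2 * L)) S fun w (o : Option (α → ℤ)) =>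
      Generic w → (o = none ∨ o = some (table v w)) ∧ (remaining v w gs H = ∅ → o ≠ none) := by
  classical
  induction gs generalizing H S with
  | nil =>
    by_cases hH : H = ∅
    · by_cases hgen : ∃ w₀ ∈ S, Generic w₀
      · obtain ⟨w₀, hw₀, hgen₀⟩ := hgen
        refine Solvable.of_leaf (some (table v w₀)) fun w hw hgw => ⟨Or.inr ?_, by simp⟩
        refine congrArg some (funext fun a => ?_)
        have := hS a (by simp [hH]) w₀ hw₀ w hw hgen₀ hgw
        simp only [table, this]
      · push Not at hgen
        exact Solvable.of_leaf none fun w hw hgw => absurd hgw (hgen w hw)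
    · refine Solvable.of_leaf none fun w _ _ => ⟨Or.inl rfl, fun h => absurd h hH⟩
  | cons g gs ih =>
    have hgH : (g H).card ≤ m := hgs g (by simp) H
    obtain ⟨U, hUc, hU⟩ := exists_containsDiffs hv (g H)
    have hUL := hL U (hUc.trans (Nat.pow_le_pow_left (by omega) 2)) S
    have hcard : (known v (g H)).card ≤ m + 1 := card_known_le.trans (by omega)
    refine (Solvable.sort (n := gs.length * (2 * (m + 1) + 2 * L)) hU (known v (g H)) ∅
      subset_rfl (empty_subset _) S ?_ fun S' hS' hc => ?_).mono ?_
    · intro w _ w' _ a ha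
      simp at ha
    · rw [empty_union] at hc
      by_cases hgen : ∃ w₀ ∈ S', Generic w₀
      swap
      · push Not at hgen
        exact Solvable.of_leaf none fun w hw hgw => absurd hgw (hgen w hw)
      obtain ⟨w₀, hw₀, hgen₀⟩ := hgen
      obtain ⟨t, h1, h2, h3⟩ := ih (fun g' hg' => hgs g' (List.mem_cons_of_mem _ hg'))
        (unresolved v w₀ (g H) H) S' (by
          intro h hh w hw w' hw' hgw hgw'
          by_cases hhH : h ∈ H
          · have hi : Inferred v (g H) w₀ h := by
              by_contra hi
              exact hh (mem_unresolved.2 ⟨hhH, hi⟩)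
            exact (hi w hgw (hc w₀ hw₀ w hw)).symm.trans (hi w' hgw' (hc w₀ hw₀ w' hw'))
          · exact hS h hhH w (hS' hw) w' (hS' hw') hgw hgw')
      refine ⟨t, h1, h2, fun w hw hgw => ?_⟩
      have hun : unresolved v w (g H) H = unresolved v w₀ (g H) H := by
        ext h
        rw [mem_unresolved, mem_unresolved]
        have hi : Inferred v (g H) w h ↔ Inferred v (g H) w₀ h :=
          ⟨fun hi => hi.congr hgen₀ (hc w hw w₀ hw₀), fun hi => hi.congr hgw (hc w₀ hw₀ w hw)⟩
        rw [hi]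
      rw [remaining, hun]
      exact h3 w hw hgw
    · rw [List.length_cons, add_mul, one_mul]
      omega

section Sampling

variable [Fintype α] [DecidableEq α]

/-- All rules choosing a sample of size `min m #H` from every set `H`. -/
def rules (α : Type) [Fintype α] [DecidableEq α] (m : ℕ) : Finset (Finset α → Finset α) :=
  Fintype.piFinset fun H => H.powersetCard (min m H.card)

lemma card_of_mem_rules {m : ℕ} {g : Finset α → Finset α} (hg : g ∈ rules α m) (H : Finset α) :
    (g H).card ≤ m := by
  have := (mem_powersetCard.1 (Fintype.mem_piFinset.1 hg H)).2
  omega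

lemma rules_nonempty (m : ℕ) : (rules α m).Nonempty :=
  Fintype.piFinset_nonempty.2 fun _ => powersetCard_nonempty.2 (min_le_right _ _)

lemma two_mul_sum_rules_le (hv : ∀ a i, v a i = 1 ∨ v a i = -1)
    (hinj : Function.Injective v) {d : ℕ} (hd : (4 * d + 1) ^ r < 2 ^ d) {m : ℕ}
    (hm : m + 1 = 4 * d) {w : Fin r → ℝ} (hw : Generic w) (H : Finset α) :
    2 * ∑ g ∈ rules α m, (unresolved v w (g H) H).card ≤ (rules α m).card * H.card := by
  set P : Finset α → Finset (Finset α) := fun H => H.powersetCard (min m H.card) with hP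
  set K := ∏ J ∈ univ.erase H, (P J).card with hK
  have hfib : ∀ s ∈ P H, #{g ∈ rules α m | g H = s} = K := fun s hs =>
    Fintype.card_filter_piFinset_eq_of_mem P H hs
  have hmaps : ∀ g ∈ rules α m, g H ∈ P H := fun g hg => Fintype.mem_piFinset.1 hg H
  have hsum : ∑ g ∈ rules α m, (unresolved v w (g H) H).card
      = K * ∑ s ∈ P H, (unresolved v w s H).card := by
    rw [← sum_fiberwise_of_maps_to hmaps, mul_sum]
    refine sum_congr rfl fun s hs => ?_
    rw [sum_congr rfl (g := fun _ => (unresolved v w s H).card), sum_const, hfib s hs, smul_eq_mul]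
    intro g hg
    rw [(mem_filter.1 hg).2]
  have hcard : (rules α m).card = K * (P H).card := by
    rw [card_eq_sum_card_fiberwise hmaps, sum_congr rfl hfib, sum_const, smul_eq_mul, mul_comm]
  have := two_mul_sum_card_unresolved_le hv hinj hd hm hw H
  calc 2 * ∑ g ∈ rules α m, (unresolved v w (g H) H).card
      = K * (2 * ∑ s ∈ P H, (unresolved v w s H).card) := by rw [hsum]; ring
    _ ≤ K * ((P H).card * H.card) := Nat.mul_le_mul_left K this
    _ = (rules α m).card * H.card := by rw [hcard]; ring

/-- Prepending the first component to the second, as an embedding. -/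
def consEmbedding (β : Type) : β × List β ↪ List β where
  toFun q := q.1 :: q.2
  inj' := by
    rintro ⟨a, l⟩ ⟨a', l'⟩ h
    obtain ⟨rfl, rfl⟩ := List.cons.inj h
    rfl

/-- Lists of `T` sampling rules. -/
def seeds (α : Type) [Fintype α] [DecidableEq α] (m : ℕ) :
    ℕ → Finset (List (Finset α → Finset α))
  | 0 => {[]}
  | T + 1 => (rules α m ×ˢ seeds α m T).map (consEmbedding _)

lemma seeds_nonempty (m T : ℕ) : (seeds α m T).Nonempty := by
  induction T with
  | zero => simp [seeds]
  | succ T ih =>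
    rw [seeds, map_nonempty]
    exact (rules_nonempty m).product ih

lemma length_and_rules_of_mem_seeds {m T : ℕ} {gs : List (Finset α → Finset α)}
    (h : gs ∈ seeds α m T) : gs.length = T ∧ ∀ g ∈ gs, g ∈ rules α m := by
  induction T generalizing gs with
  | zero =>
    rw [seeds, mem_singleton] at h
    simp [h]
  | succ T ih =>
    rw [seeds, mem_map] at h
    obtain ⟨⟨g, gs'⟩, hq, rfl⟩ := h
    rw [mem_product] at hq
    obtain ⟨h1, h2⟩ := ih hq.2
    refine ⟨congrArg Nat.succ h1, fun g' hg' => ?_⟩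
    rcases List.mem_cons.1 hg' with rfl | hg'
    · exact hq.1
    · exact h2 g' hg'

lemma card_filter_remaining_le (hv : ∀ a i, v a i = 1 ∨ v a i = -1)
    (hinj : Function.Injective v) {d : ℕ} (hd : (4 * d + 1) ^ r < 2 ^ d) {m : ℕ}
    (hm : m + 1 = 4 * d) {w : Fin r → ℝ} (hw : Generic w) (T : ℕ) (H : Finset α) :
    #{gs ∈ seeds α m T | remaining v w gs H ≠ ∅} * 2 ^ T ≤ (seeds α m T).card * H.card := by
  induction T generalizing H with
  | zero =>
    rcases H.eq_empty_or_nonempty with rfl | hH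
    · simp [seeds, remaining, filter_singleton]
    · have h1 := card_pos.2 hH
      refine (Nat.mul_le_mul_right _ (card_filter_le _ _)).trans ?_
      simpa using Nat.mul_le_mul_left _ h1
  | succ T ih =>
    have hsplit : #{gs ∈ seeds α m (T + 1) | remaining v w gs H ≠ ∅}
        = ∑ g ∈ rules α m,
          #{gs ∈ seeds α m T | remaining v w gs (unresolved v w (g H) H) ≠ ∅} := by
      simp only [card_filter]
      rw [seeds, sum_map, sum_product]
      rfl
    have hcard : (seeds α m (T + 1)).card = (rules α m).card * (seeds α m T).card := by
      rw [seeds, card_map, card_product]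
    rw [hsplit, hcard, sum_mul]
    calc ∑ g ∈ rules α m,
          #{gs ∈ seeds α m T | remaining v w gs (unresolved v w (g H) H) ≠ ∅} * 2 ^ (T + 1)
        ≤ ∑ g ∈ rules α m, 2 * ((seeds α m T).card * (unresolved v w (g H) H).card) := by
          refine sum_le_sum fun g _ => ?_
          have := ih (unresolved v w (g H) H)
          rw [pow_succ]
          linarith
      _ = (seeds α m T).card * (2 * ∑ g ∈ rules α m, (unresolved v w (g H) H).card) := by
          rw [mul_sum, mul_sum]
          exact sum_congr rfl fun g _ => by ring
      _ ≤ (seeds α m T).card * ((rules α m).card * H.card) :=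
          Nat.mul_le_mul_left _ (two_mul_sum_rules_le hv hinj hd hm hw H)
      _ = (rules α m).card * (seeds α m T).card * H.card := by ring

end Sampling

end Inference

lemma four_mul_add_one_lt {r ℓ : ℕ} (hr : r < 2 ^ ℓ) (hℓ : 0 < ℓ) :
    4 * (8 * r * ℓ) + 1 < 2 ^ (8 * ℓ) := by
  have h1 : ℓ < 2 ^ ℓ := Nat.lt_two_pow_self
  have h2 : 2 ≤ 2 ^ ℓ := by simpa using Nat.pow_le_pow_right (n := 2) (by norm_num) hℓ
  rw [mul_comm 8 ℓ, pow_mul]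
  set x := 2 ^ ℓ
  have h3 : r * ℓ ≤ x * x := Nat.mul_le_mul hr.le h1.le
  have h4 : 2 ^ 6 ≤ x ^ 6 := Nat.pow_le_pow_left h2 6
  have h5 : 2 ^ 6 * (x * x) ≤ x ^ 6 * (x * x) := Nat.mul_le_mul_right _ h4
  have h6 : x ^ 8 = x ^ 6 * (x * x) := by ring
  nlinarith

lemma log_patCard_le {M b : ℕ} (hM : M + 1 ≤ 2 ^ b) (U : Finset (Fin r → ℤ))
    (hU : U.card ≤ M ^ 2) (S : Set (Fin r → ℝ)) : Nat.log 2 (patCard U S) ≤ 2 * b * r := by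
  have h1 : U.card + 1 ≤ 2 ^ (2 * b) := by
    calc U.card + 1 ≤ M ^ 2 + 1 := by omega
      _ ≤ (M + 1) ^ 2 := by nlinarith
      _ ≤ (2 ^ b) ^ 2 := Nat.pow_le_pow_left hM 2
      _ = 2 ^ (2 * b) := by rw [← pow_mul, mul_comm]
  have h2 : patCard U S ≤ 2 ^ (2 * b * r) := by
    rw [pow_mul]
    exact (patCard_le U S).trans (Nat.pow_le_pow_left h1 r)
  exact (Nat.log_mono_right h2).trans_eq (Nat.log_pow (by norm_num) _)

/-- The distribution over trees for `T` rounds, with explicit depth and failure probability. -/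
lemma exists_pmf {α : Type} [Fintype α] {v : α → Fin r → ℤ} (hr : 2 ≤ r)
    (hv : ∀ a i, v a i = 1 ∨ v a i = -1) (hinj : Function.Injective v) (T : ℕ) :
    ∃ D : PMF (LDT (Fin r) (Option (α → ℤ))), D.support.Finite ∧
      (∀ t ∈ D.support, t.depth ≤ T * (96 * r * (Nat.log 2 r + 1)) ∧ t.SmallCoeffs) ∧
      ∀ w : Fin r → ℝ, Generic w →
        (∀ t ∈ D.support, t.eval w = none ∨ t.eval w = some (table v w)) ∧
        D.toOuterMeasure {t | t.eval w = none} ≤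
          ENNReal.ofReal ((Fintype.card α : ℝ) / 2 ^ T) := by
  classical
  set ℓ := Nat.log 2 r + 1 with hℓ
  have hrℓ : r < 2 ^ ℓ := Nat.lt_pow_succ_log_self (by norm_num) r
  have hb := four_mul_add_one_lt hrℓ (Nat.succ_pos _)
  set d := 8 * r * ℓ with hd_def
  have hd : (4 * d + 1) ^ r < 2 ^ d := by
    have : 2 ^ d = (2 ^ (8 * ℓ)) ^ r := by rw [← pow_mul, hd_def]; ring_nf
    rw [this]
    exact Nat.pow_lt_pow_left hb (by omega)
  have hdpos : 0 < d := by positivity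
  obtain ⟨m, hm⟩ : ∃ m, m + 1 = 4 * d := ⟨4 * d - 1, by omega⟩
  have hL : ∀ U : Finset (Fin r → ℤ), U.card ≤ (m + 1) ^ 2 → ∀ S,
      Nat.log 2 (patCard U S) ≤ 2 * (8 * ℓ) * r := fun U hU S =>
    log_patCard_le (by omega) U hU S
  have hdepth : 2 * (m + 1) + 2 * (2 * (8 * ℓ) * r) = 96 * r * ℓ := by
    rw [hm, hd_def]
    ring
  have htree : ∀ gs : List (Finset α → Finset α), gs ∈ seeds α m T →
      ∃ t : LDT (Fin r) (Option (α → ℤ)), t.depth ≤ T * (96 * r * ℓ) ∧ t.SmallCoeffs ∧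
        ∀ w, Generic w → (t.eval w = none ∨ t.eval w = some (table v w)) ∧
          (remaining v w gs univ = ∅ → t.eval w ≠ none) := by
    intro gs hgs
    obtain ⟨hlen, hrules⟩ := length_and_rules_of_mem_seeds hgs
    obtain ⟨t, h1, h2, h3⟩ := solvable_rounds hv hL gs
      (fun g hg H => card_of_mem_rules (hrules g hg) H) univ Set.univ (by simp)
    rw [hlen, hdepth] at h1
    exact ⟨t, h1, h2, fun w hw => h3 w (Set.mem_univ w) hw⟩
  have : Nonempty (LDT (Fin r) (Option (α → ℤ))) := ⟨leaf none⟩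
  choose! tree htd hts hte using htree
  have hsupp : ((PMF.uniformOfFinset (seeds α m T) (seeds_nonempty m T)).map tree).support
      = tree '' (seeds α m T) := by
    rw [PMF.support_map, PMF.support_uniformOfFinset]
  refine ⟨(PMF.uniformOfFinset (seeds α m T) (seeds_nonempty m T)).map tree, ?_, ?_, ?_⟩
  · rw [hsupp]
    exact (finite_toSet _).image _
  · rw [hsupp]
    rintro _ ⟨gs, hgs, rfl⟩
    exact ⟨htd gs hgs, hts gs hgs⟩
  · intro w hw
    refine ⟨?_, ?_⟩
    · rw [hsupp]
      rintro _ ⟨gs, hgs, rfl⟩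
      exact (hte gs hgs w hw).1
    · rw [PMF.toOuterMeasure_map_apply, PMF.toOuterMeasure_uniformOfFinset_apply]
      have hsub : #{gs ∈ seeds α m T | gs ∈ tree ⁻¹' {t | t.eval w = none}}
          ≤ #{gs ∈ seeds α m T | remaining v w gs univ ≠ ∅} := by
        refine card_le_card fun gs hgs => ?_
        rw [mem_filter] at hgs ⊢
        exact ⟨hgs.1, fun he => (hte gs hgs.1 w hw).2 he hgs.2⟩
      have hcount := (Nat.mul_le_mul_right (2 ^ T) hsub).trans
        (card_filter_remaining_le hv hinj hd hm hw T univ)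
      have hspos : 0 < (seeds α m T).card := card_pos.2 (seeds_nonempty m T)
      set x := #{gs ∈ seeds α m T | gs ∈ tree ⁻¹' {t | t.eval w = none}}
      have hreal : (x : ℝ) / (seeds α m T).card ≤ (Fintype.card α : ℝ) / 2 ^ T := by
        rw [div_le_div_iff₀ (by exact_mod_cast hspos) (by positivity)]
        rw [card_univ] at hcount
        have : (x : ℝ) * 2 ^ T ≤ (seeds α m T).card * Fintype.card α := by exact_mod_cast hcount
        linarith
      refine le_trans (le_of_eq ?_) (ENNReal.ofReal_le_ofReal hreal)
      rw [ENNReal.ofReal_div_of_pos (by exact_mod_cast hspos), ENNReal.ofReal_natCast,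
        ENNReal.ofReal_natCast]

lemma exists_rounds {N : ℝ} (hN : 1 ≤ N) {ε : ℝ} (hε : 0 < ε) (hε1 : ε < 1) :
    ∃ T : ℕ, N / 2 ^ T ≤ ε ∧ (T : ℝ) ≤ 2 * Real.log (2 * N / ε) := by
  have hq : 1 ≤ N / ε := by
    rw [le_div_iff₀ hε]
    linarith
  have hl2 : (1 : ℝ) / 2 < Real.log 2 := by
    have := Real.log_two_gt_d9
    linarith
  have hlog : 0 ≤ Real.logb 2 (N / ε) := Real.logb_nonneg (by norm_num) hq
  refine ⟨⌈Real.logb 2 (N / ε)⌉₊, ?_, ?_⟩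
  · have h1 := (Real.logb_le_iff_le_rpow (by norm_num) (by linarith)).1
      (Nat.le_ceil (Real.logb 2 (N / ε)))
    rw [Real.rpow_natCast, div_le_iff₀ hε] at h1
    rw [div_le_iff₀ (by positivity)]
    linarith
  · have h1 : (⌈Real.logb 2 (N / ε)⌉₊ : ℝ) ≤ Real.logb 2 (N / ε) + 1 := (Nat.ceil_lt_add_one hlog).le
    refine h1.trans ?_
    have h2 : Real.log (2 * N / ε) = Real.log 2 + Real.log (N / ε) := by
      rw [mul_div_assoc, Real.log_mul (by norm_num) (by linarith)]
    have h3 : 0 ≤ Real.log (N / ε) := Real.log_nonneg hq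
    have h4 : Real.logb 2 (N / ε) + 1 = (Real.log (N / ε) + Real.log 2) / Real.log 2 := by
      rw [Real.logb]
      field_simp
    rw [h4, h2, div_le_iff₀ (by linarith)]
    nlinarith

lemma natLog_two_add_one_le {r : ℕ} (hr : 2 ≤ r) : ((Nat.log 2 r + 1 : ℕ) : ℝ) ≤ 4 * Real.log r := by
  have hl2 : (1 : ℝ) / 2 < Real.log 2 := by
    have := Real.log_two_gt_d9
    linarith
  have h1 : 1 ≤ Nat.log 2 r := Nat.log_pos (by norm_num) hr
  have h2 : (Nat.log 2 r : ℝ) * Real.log 2 ≤ Real.log r := by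
    rw [← Real.log_pow]
    refine Real.log_le_log (by positivity) ?_
    exact_mod_cast Nat.pow_log_le_self 2 (by omega)
  have h3 : (1 : ℝ) ≤ Nat.log 2 r := by exact_mod_cast h1
  push_cast
  nlinarith

end LDT

/-- **Kane–Lovett–Moran–Zhang** (Theorem 2.1, without the running-time clause).
There is an absolute constant `C > 0` such that for every `r ≥ 2`, every nonempty
`H ⊆ {-1,1}^r` and every `ε ∈ (0,1)` there is a finitely supported distribution `D`
over linear decision trees of depth `O(r log r · log(2|H|/ε))` with queries having
coefficients in `{-2,…,2}`, which on every input `w ∈ ℝ^r` with `⟨w,a⟩ ≠ 0` for all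
`a ∈ {-1,1}^r` outputs either `?` (= `none`) or the truth table on `H` of the LTF
`a ↦ sgn(⟨w,a⟩)`, and outputs `?` with probability at most `ε`. -/
theorem klmz_ldt_for_ltf :
    ∃ C : ℝ, 0 < C ∧
      ∀ (r : ℕ), 2 ≤ r →
      ∀ (H : Finset (Fin r → ℝ)), H.Nonempty →
        (∀ a ∈ H, ∀ i, a i = 1 ∨ a i = -1) →
      ∀ ε : ℝ, 0 < ε → ε < 1 →
        ∃ D : PMF (LDT (Fin r) (Option ({a // a ∈ H} → ℤ))),
          D.support.Finite ∧
          (∀ T ∈ D.support,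
            (T.depth : ℝ) ≤ C * r * Real.log r * Real.log (2 * H.card / ε) ∧
            T.SmallCoeffs) ∧
          (∀ w : Fin r → ℝ,
            (∀ a : Fin r → ℝ, (∀ i, a i = 1 ∨ a i = -1) → ∑ i, w i * a i ≠ 0) →
            (∀ T ∈ D.support,
              T.eval w = none ∨
              T.eval w =
                some (fun a => if 0 < ∑ i, w i * a.1 i then 1 else -1)) ∧
            D.toOuterMeasure {T | T.eval w = none} ≤ ENNReal.ofReal ε) := by
  classical
  refine ⟨768, by norm_num, fun r hr H hH hsign ε hε hε1 => ?_⟩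
  let v : {a // a ∈ H} → Fin r → ℤ := fun a i => if a.1 i = 1 then 1 else -1
  have hv : ∀ a i, v a i = 1 ∨ v a i = -1 := fun a i => by
    simp only [v]
    split_ifs <;> simp
  have hcast : ∀ a i, (v a i : ℝ) = a.1 i := fun a i => by
    simp only [v]
    split_ifs with h
    · simp [h]
    · simp [(hsign a.1 a.2 i).resolve_left h]
  have hinj : Function.Injective v := fun a b hab => by
    refine Subtype.ext (funext fun i => ?_)
    rw [← hcast, ← hcast, hab]
  have hdot : ∀ w a, LDT.dot w (v a) = ∑ i, w i * a.1 i := fun w a => by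
    simp only [LDT.dot, hcast, mul_comm]
  have hN : (1 : ℝ) ≤ H.card := by exact_mod_cast Finset.card_pos.2 hH
  obtain ⟨T, hT1, hT2⟩ := LDT.exists_rounds hN hε hε1
  obtain ⟨D, hfin, hdepth, heval⟩ := LDT.exists_pmf hr hv hinj T
  refine ⟨D, hfin, fun t ht => ⟨?_, (hdepth t ht).2⟩, fun w hw => ?_⟩
  · have h1 : (t.depth : ℝ) ≤ T * (96 * r * (Nat.log 2 r + 1 : ℕ)) := by
      exact_mod_cast (hdepth t ht).1
    have h2 := LDT.natLog_two_add_one_le hr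
    have h3 : (0 : ℝ) ≤ 4 * Real.log r := le_trans (by positivity) h2
    have h4 : (0 : ℝ) ≤ 2 * Real.log (2 * H.card / ε) := (Nat.cast_nonneg T).trans hT2
    calc (t.depth : ℝ) ≤ T * (96 * r * (Nat.log 2 r + 1 : ℕ)) := h1
      _ ≤ (2 * Real.log (2 * H.card / ε)) * (96 * r * (4 * Real.log r)) := by gcongr
      _ = 768 * r * Real.log r * Real.log (2 * H.card / ε) := by ring
  · have hgen : LDT.Generic w := fun a ha => by
      have := hw (fun i => (a i : ℝ)) fun i => by
        rcases ha i with h | h <;> simp [h]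
      simpa only [LDT.dot, mul_comm] using this
    have htable : LDT.table v w
        = fun a : {a // a ∈ H} => if 0 < ∑ i, w i * a.1 i then (1 : ℤ) else -1 := by
      funext a
      simp only [LDT.table, hdot]
    obtain ⟨h1, h2⟩ := heval w hgen
    rw [htable] at h1
    refine ⟨h1, h2.trans (ENNReal.ofReal_le_ofReal ?_)⟩
    rwa [Fintype.card_coe]
end

section
/- Fix positive integer constants k and c. There is a constant C > 0 (depending only on k and c) such that for every integer m ≥ 2 and every positive integer ℓ ≤ m^c the following holds. Let r = Σ_{i=0}^{k} binom(m,i), and identify ℝ^{r·ℓ} with ℓ-tuples (v₁,…,v_ℓ) of vectors indexed by the subsets S ⊆ {1,…,m} with |S| ≤ k; for such a vector v, let P_v denote the multilinear polynomial P_v(x) = Σ_{S : |S| ≤ k} v(S)·Π_{i∈S} x_i. Then there exists a finitely supported probability distribution D over linear decision trees over ℝ^{r·ℓ} with output values in ℕ ∪ {?} satisfying: (1) every tree in the support of D has depth at most C·ℓ·m^{k+1}·log m and all of its linear queries have integer coefficient vectors with every entry in {-2,-1,0,1,2}; (2) for every input tuple (v₁,…,v_ℓ) such that P_{v_i}(b)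 ≠ 0 for every i ∈ {1,…,ℓ} and every b ∈ {-1,1}^m, every tree in the support of D outputs on this input either ? or the number |{b ∈ {-1,1}^m : P_{v_i}(b) < 0 for all i ∈ {1,…,ℓ}}|, and the probability over a tree T drawn from D that T outputs ? on this input is at most 1/2. -/
/-- The value at `b ∈ ℝ^m` of the degree-`k` multilinear polynomial whose coefficient
vector is `v`, indexed by the subsets `S ⊆ {1,…,m}` of size at most `k`:
`P_v(b) = ∑_{|S| ≤ k} v(S) · ∏_{i ∈ S} b i`. -/
def polyVal {m k : ℕ} (v : {S : Finset (Fin m) // S.card ≤ k} → ℝ)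
    (b : Fin m → ℝ) : ℝ :=
  ∑ S : {S : Finset (Fin m) // S.card ≤ k}, v S * ∏ i ∈ (S : Finset (Fin m)), b i

/-- The point of `{-1,1}^m` associated to `b : Fin m → Bool`. -/
def boolToPM {m : ℕ} (b : Fin m → Bool) : Fin m → ℝ :=
  fun i => if b i then 1 else -1


namespace LDT

variable {ι α S U : Type}

/-- Continue at each leaf of a tree with the tree assigned to its label. -/
def bind : LDT ι S → (S → LDT ι U) → LDT ι U
  | leaf s, f => f s
  | node w θ l r, f => node w θ (l.bind f) (r.bind f)

theorem eval_bind [Fintype ι] (T : LDT ι S) (f : S → LDT ι U) (z : ι → ℝ) :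
    (T.bind f).eval z = (f (T.eval z)).eval z := by
  induction T with
  | leaf s => rfl
  | node w θ l r hl hr =>
    simp only [bind, eval, hl, hr]
    split_ifs <;> rfl

theorem depth_bind_le (T : LDT ι S) {f : S → LDT ι U} {K : ℕ} (hf : ∀ s, (f s).depth ≤ K) :
    (T.bind f).depth ≤ T.depth + K := by
  induction T with
  | leaf s => simpa [bind, depth] using hf s
  | node w θ l r hl hr =>
    simp only [bind, depth]
    omega

theorem SmallCoeffs.bind {T : LDT ι S} (hT : T.SmallCoeffs) {f : S → LDT ι U}
    (hf : ∀ s, (f s).SmallCoeffs) : (T.bind f).SmallCoeffs := by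
  induction T with
  | leaf s => exact hf s
  | node w θ l r hl hr => exact ⟨hT.1, hl hT.2.1, hr hT.2.2⟩

/-- Run a tree on the block of the input with index `a`. -/
def onBlock [DecidableEq α] (a : α) : LDT ι S → LDT (α × ι) S
  | leaf s => leaf s
  | node w θ l r =>
      node (fun p => if p.1 = a then w p.2 else 0) θ (l.onBlock a) (r.onBlock a)

theorem eval_onBlock [Fintype ι] [Fintype α] [DecidableEq α] (a : α) (T : LDT ι S)
    (z : α × ι → ℝ) : (T.onBlock a).eval z = T.eval (fun i => z (a, i)) := by
  induction T with
  | leaf s => rfl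
  | node w θ l r hl hr =>
    have : ∑ p : α × ι, ((if p.1 = a then w p.2 else 0 : ℤ) : ℝ) * z p
        = ∑ i, (w i : ℝ) * z (a, i) := by
      rw [Fintype.sum_prod_type, Finset.sum_eq_single a]
      · simp
      · intro b _ hb
        simp [hb]
      · simp
    simp only [onBlock, eval, hl, hr, this]

theorem depth_onBlock [DecidableEq α] (a : α) (T : LDT ι S) : (T.onBlock a).depth = T.depth := by
  induction T with
  | leaf s => rfl
  | node w θ l r hl hr => simp only [onBlock, depth, hl, hr]

theorem SmallCoeffs.onBlock [DecidableEq α] (a : α) {T : LDT ι S} (hT : T.SmallCoeffs) :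
    (T.onBlock a).SmallCoeffs := by
  induction T with
  | leaf s => trivial
  | node w θ l r hl hr =>
    refine ⟨fun p => ?_, hl hT.2.1, hr hT.2.2⟩
    dsimp only
    split_ifs
    · exact hT.1 p.2
    · simp

end LDT

section Inference

variable {ι : Type} [Fintype ι]

/-- The value of the integer linear form `w` at the point `x`. -/
noncomputable def formVal (w : ι → ℤ) (x : ι → ℝ) : ℝ := ∑ i, (w i : ℝ) * x i

theorem formVal_zero (x : ι → ℝ) : formVal 0 x = 0 := by simp [formVal]

theorem formVal_sub (u v : ι → ℤ) (x : ι → ℝ) :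
    formVal (u - v) x = formVal u x - formVal v x := by
  simp [formVal, sub_mul, Finset.sum_sub_distrib]

/-- Two points order the values of the forms in `L` in the same way. -/
def Agree (L : Set (ι → ℤ)) (x y : ι → ℝ) : Prop :=
  ∀ g ∈ L, ∀ h ∈ L, formVal g x ≤ formVal h x ↔ formVal g y ≤ formVal h y

theorem Agree.symm {L : Set (ι → ℤ)} {x y : ι → ℝ} (h : Agree L x y) : Agree L y x :=
  fun g hg g' hg' => (h g hg g' hg').symm

theorem Agree.trans {L : Set (ι → ℤ)} {x y z : ι → ℝ} (h : Agree L x y) (h' : Agree L y z) :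
    Agree L x z :=
  fun g hg g' hg' => (h g hg g' hg').trans (h' g hg g' hg')

theorem Agree.mono {L M : Set (ι → ℤ)} {x y : ι → ℝ} (hLM : L ⊆ M) (h : Agree M x y) :
    Agree L x y :=
  fun u hu v hv => h u (hLM hu) v (hLM hv)

/-- The order of the values of the forms in `L` at `x` determines the sign of `h` at `x`. -/
def Infers (L : Set (ι → ℤ)) (h : ι → ℤ) (x : ι → ℝ) : Prop :=
  ∀ y, Agree L x y → (0 ≤ formVal h x ↔ 0 ≤ formVal h y)

theorem Infers.mono {L M : Set (ι → ℤ)} {h : ι → ℤ} {x : ι → ℝ} (hLM : L ⊆ M)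
    (hL : Infers L h x) : Infers M h x :=
  fun y hy => hL y (hy.mono hLM)

theorem Infers.congr_point {L : Set (ι → ℤ)} {h : ι → ℤ} {x y : ι → ℝ} (hxy : Agree L x y)
    (hx : Infers L h x) : Infers L h y :=
  fun z hz => (hx y hxy).symm.trans (hx z (hxy.trans hz))

theorem infers_iff_of_agree {L : Set (ι → ℤ)} {h : ι → ℤ} {x y : ι → ℝ} (hxy : Agree L x y) :
    Infers L h x ↔ Infers L h y :=
  ⟨Infers.congr_point hxy, Infers.congr_point hxy.symm⟩

/-- By pigeonhole, in a long sequence of bounded integer vectors some term is the first term plus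
a nonnegative combination of the consecutive differences strictly before it. -/
theorem exists_eq_add_sum_consecutive_differences (n : ℕ)
    (hn : (4 * n + 1) ^ Fintype.card ι < 2 ^ n) (a : ℕ → ι → ℤ) (ha : ∀ j i, |a j i| ≤ 1) :
    ∃ q < n, ∃ c : ℕ → ℤ, (∀ i, 0 ≤ c i) ∧
      a (q + 1) = a 0 + ∑ i ∈ Finset.range q, c i • (a (i + 1) - a i) := by
  classical
  let δ : ℕ → ι → ℤ := fun i => a (i + 1) - a i
  let f : Finset ℕ → ι → ℤ := fun E => ∑ i ∈ E, δ i
  have hmaps : ∀ E ∈ (Finset.range n).powerset,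
      f E ∈ Fintype.piFinset (fun _ : ι => Finset.Icc (-(2 * n : ℤ)) (2 * n)) := by
    intro E hE
    rw [Fintype.mem_piFinset]
    intro i
    rw [Finset.mem_Icc, ← abs_le]
    have hcard : (E.card : ℤ) ≤ n := by
      have := Finset.card_le_card (Finset.mem_powerset.1 hE)
      rw [Finset.card_range] at this
      exact_mod_cast this
    calc |f E i| = |∑ j ∈ E, δ j i| := by simp [f, Finset.sum_apply]
      _ ≤ ∑ j ∈ E, |δ j i| := Finset.abs_sum_le_sum_abs _ _
      _ ≤ ∑ j ∈ E, (2 : ℤ) := by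
        refine Finset.sum_le_sum fun j _ => ?_
        have h1 := ha (j + 1) i
        have h2 := ha j i
        simp only [δ, Pi.sub_apply]
        rw [abs_le] at *
        omega
      _ ≤ 2 * n := by simp; omega
  obtain ⟨E, hE, F, hF, hEF, hsum⟩ := Finset.exists_ne_map_eq_of_card_lt_of_maps_to (by
    rw [Fintype.card_piFinset, Finset.card_powerset, Finset.card_range]
    have hIcc : (Finset.Icc (-(2 * n : ℤ)) (2 * n)).card = 4 * n + 1 := by
      rw [Int.card_Icc]
      omega
    simpa [hIcc] using hn) hmaps
  let α : ℕ → ℤ := fun i => (if i ∈ E then 1 else 0) - (if i ∈ F then 1 else 0)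
  have hα : ∑ i ∈ Finset.range n, α i • δ i = 0 := by
    have key : ∀ G ∈ (Finset.range n).powerset,
        ∑ i ∈ Finset.range n, (if i ∈ G then (1 : ℤ) else 0) • δ i = f G := by
      intro G hG
      simp only [ite_smul, one_smul, zero_smul, f]
      rw [← Finset.sum_filter, Finset.filter_mem_eq_inter,
        Finset.inter_eq_right.2 (Finset.mem_powerset.1 hG)]
    simp only [α, sub_smul, Finset.sum_sub_distrib]
    rw [key E hE, key F hF, hsum, sub_self]
  have hne : ((Finset.range n).filter fun i => α i ≠ 0).Nonempty := by
    by_contra hemp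
    rw [Finset.not_nonempty_iff_eq_empty, Finset.filter_eq_empty_iff] at hemp
    apply hEF
    ext i
    by_cases hi : i ∈ Finset.range n
    · have := hemp hi
      simp only [α] at this
      by_cases h1 : i ∈ E <;> by_cases h2 : i ∈ F <;> simp [h1, h2] at this ⊢
    · exact ⟨fun h => absurd (Finset.mem_powerset.1 hE h) hi,
        fun h => absurd (Finset.mem_powerset.1 hF h) hi⟩
  obtain ⟨q, hq, hmax⟩ := Finset.exists_max_image _ id hne
  rw [Finset.mem_filter, Finset.mem_range] at hq
  have hαbound : ∀ i, α i = 0 ∨ α i = 1 ∨ α i = -1 := by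
    intro i
    by_cases h1 : i ∈ E <;> by_cases h2 : i ∈ F <;> simp [α, h1, h2]
  have hαq : α q * α q = 1 := by
    rcases hαbound q with h | h | h
    · exact absurd h hq.2
    · simp [h]
    · simp [h]
  have hzero : ∑ i ∈ Finset.range (q + 1), α i • δ i = 0 := by
    rw [← hα]
    refine Finset.sum_subset (fun i hi => ?_) fun i hi hi' => ?_
    · rw [Finset.mem_range] at *
      omega
    · have : α i = 0 := by
        by_contra h
        have := hmax i (Finset.mem_filter.2 ⟨hi, h⟩)
        simp only [id, Finset.mem_range] at this hi'
        omega
      simp [this]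
  rw [Finset.sum_range_succ] at hzero
  refine ⟨q, hq.1, fun i => 1 - α q * α i, fun i => ?_, ?_⟩
  · rcases hαbound i with h | h | h <;> rcases hαbound q with h' | h' | h' <;> simp [h, h']
  · have htel : ∑ i ∈ Finset.range q, δ i = a q - a 0 := Finset.sum_range_sub a q
    have hδq : δ q = -∑ i ∈ Finset.range q, (α q * α i) • δ i := by
      have h := congrArg (fun t => α q • t) hzero
      simp only [smul_add, smul_smul, hαq, one_smul, smul_zero, Finset.smul_sum] at h
      exact eq_neg_of_add_eq_zero_right h
    have hsub : ∑ i ∈ Finset.range q, (1 - α q * α i) • (a (i + 1) - a i) =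
        ∑ i ∈ Finset.range q, δ i - ∑ i ∈ Finset.range q, (α q * α i) • δ i := by
      simp only [sub_smul, one_smul, Finset.sum_sub_distrib, δ]
    have hlast : a (q + 1) = a q + δ q := by simp [δ]
    rw [hsub, htel, hlast, hδq]
    abel

theorem formVal_add_sum (u : ι → ℤ) (s : Finset ℕ) (c : ℕ → ℤ) (d : ℕ → ι → ℤ) (x : ι → ℝ) :
    formVal (u + ∑ i ∈ s, c i • d i) x = formVal u x + ∑ i ∈ s, (c i : ℝ) * formVal (d i) x := by
  simp only [formVal, Pi.add_apply, Finset.sum_apply, Pi.smul_apply, smul_eq_mul, Int.cast_add,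
    Int.cast_sum, Int.cast_mul, add_mul, Finset.sum_add_distrib, Finset.sum_mul, Finset.mul_sum]
  congr 1
  rw [Finset.sum_comm]
  simp only [mul_assoc]

/-- Among sufficiently many bounded forms with the same sign at `x`, one is inferred by the
others. -/
theorem exists_infers_erase {γ : Type} [DecidableEq γ] (n : ℕ)
    (hn : (4 * n + 1) ^ Fintype.card ι < 2 ^ n) (u : γ → ι → ℤ) (hu : ∀ j i, |u j i| ≤ 1)
    (x : ι → ℝ) (A : Finset γ) (hA : A.card = n + 1)
    (hsign : (∀ j ∈ A, 0 ≤ formVal (u j) x) ∨ ∀ j ∈ A, ¬ 0 ≤ formVal (u j) x) :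
    ∃ g ∈ A, Infers (insert 0 (u '' {j | j ∈ A ∧ j ≠ g})) (u g) x := by
  classical
  let e : Fin (n + 1) ≃ A := (A.equivFinOfCardEq hA).symm
  let σ := Tuple.sort (fun i => formVal (u (e i)) x)
  have hmono : Monotone fun i => formVal (u (e (σ i))) x :=
    Tuple.monotone_sort (fun i => formVal (u (e i)) x)
  have extract : ∀ b : Fin (n + 1) → γ, ∃ q : ℕ, ∃ hq : q < n, ∃ c : ℕ → ℤ, (∀ i, 0 ≤ c i) ∧
        ∀ y, formVal (u (b ⟨q + 1, by omega⟩)) y = formVal (u (b 0)) y +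
          ∑ i ∈ Finset.range q, (c i : ℝ) *
            (formVal (u (b (Fin.ofNat (n + 1) (i + 1)))) y -
              formVal (u (b (Fin.ofNat (n + 1) i))) y) := by
    intro b
    obtain ⟨q, hq, c, hc, h⟩ := exists_eq_add_sum_consecutive_differences n hn
      (fun j => u (b (Fin.ofNat (n + 1) j))) (fun j i => hu _ i)
    refine ⟨q, hq, c, hc, fun y => ?_⟩
    have h' := congrArg (fun w => formVal w y) h
    simp only [formVal_add_sum, formVal_sub] at h'
    have e1 : (⟨q + 1, by omega⟩ : Fin (n + 1)) = Fin.ofNat (n + 1) (q + 1) := by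
      ext
      simp [Nat.mod_eq_of_lt (show q + 1 < n + 1 by omega)]
    rw [e1, h']
    rfl
  have hval : ∀ i, i < n + 1 → (Fin.ofNat (n + 1) i : Fin (n + 1)).val = i := by
    intro i hi
    simp [Nat.mod_eq_of_lt hi]
  have hmem : ∀ (b : Fin (n + 1) → γ), Function.Injective b → (∀ i, b i ∈ A) →
      ∀ q, ∀ hq : q < n, ∀ i : Fin (n + 1), i.val ≤ q →
      u (b i) ∈ insert (0 : ι → ℤ) (u '' {j | j ∈ A ∧ j ≠ b ⟨q + 1, by omega⟩}) := by
    intro b hb hbA q hq i hi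
    refine Or.inr ⟨b i, ⟨hbA i, fun h => ?_⟩, rfl⟩
    have := congrArg Fin.val (hb h)
    simp only at this
    omega
  rcases hsign with hpos | hneg
  · let b : Fin (n + 1) → γ := fun i => e (σ i)
    have hb : Function.Injective b :=
      Subtype.val_injective.comp (e.injective.comp σ.injective)
    have hbA : ∀ i, b i ∈ A := fun i => (e (σ i)).2
    obtain ⟨q, hq, c, hc, h⟩ := extract b
    refine ⟨b ⟨q + 1, by omega⟩, hbA _, fun y hy => ?_⟩
    refine iff_of_true (hpos _ (hbA _)) ?_
    rw [h y]
    have h0 : 0 ≤ formVal (u (b 0)) y := by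
      have := (hy 0 (Or.inl rfl) _ (hmem b hb hbA q hq 0 (Nat.zero_le _))).1
        (by rw [formVal_zero]; exact hpos _ (hbA _))
      rwa [formVal_zero] at this
    refine add_nonneg h0 (Finset.sum_nonneg fun i hi => mul_nonneg (by exact_mod_cast hc i) ?_)
    rw [Finset.mem_range] at hi
    have v1 := hval i (by omega)
    have v2 := hval (i + 1) (by omega)
    refine sub_nonneg.2 ((hy _ (hmem b hb hbA q hq _ (by omega)) _
      (hmem b hb hbA q hq _ (by omega))).1 (hmono ?_))
    rw [Fin.le_def]
    omega
  · let b : Fin (n + 1) → γ := fun i => e (σ i.rev)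
    have hb : Function.Injective b :=
      Subtype.val_injective.comp (e.injective.comp (σ.injective.comp Fin.rev_injective))
    have hbA : ∀ i, b i ∈ A := fun i => (e (σ i.rev)).2
    obtain ⟨q, hq, c, hc, h⟩ := extract b
    refine ⟨b ⟨q + 1, by omega⟩, hbA _, fun y hy => ?_⟩
    refine iff_of_false (hneg _ (hbA _)) ?_
    rw [h y, not_le]
    have h0 : formVal (u (b 0)) y < 0 := by
      have := mt (hy 0 (Or.inl rfl) _ (hmem b hb hbA q hq 0 (Nat.zero_le _))).2
        (by rw [formVal_zero]; exact hneg _ (hbA _))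
      rwa [formVal_zero, not_le] at this
    refine add_neg_of_neg_of_nonpos h0
      (Finset.sum_nonpos fun i hi => mul_nonpos_of_nonneg_of_nonpos (by exact_mod_cast hc i) ?_)
    rw [Finset.mem_range] at hi
    have v1 := hval i (by omega)
    have v2 := hval (i + 1) (by omega)
    refine sub_nonpos.2 ((hy _ (hmem b hb hbA q hq _ (by omega)) _
      (hmem b hb hbA q hq _ (by omega))).1 (hmono ?_))
    rw [Fin.rev_le_rev, Fin.le_def]
    omega

/-- The forms compared when the sample `s` from the family `v` is sorted together with `0`. -/
def sampleForms {β : Type} (v : β → ι → ℤ) {n : ℕ} (s : Fin n → β) : Set (ι → ℤ) :=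
  insert 0 (Set.range fun i => v (s i))

open Classical in
/-- In any tuple of bounded forms, few are not inferred by the others. -/
theorem card_not_infers_removeNth_le {β : Type} (v : β → ι → ℤ) (hv : ∀ b i, |v b i| ≤ 1) (d : ℕ)
    (hd : (4 * d + 1) ^ Fintype.card ι < 2 ^ d) {n : ℕ} (t : Fin (n + 1) → β) (x : ι → ℝ) :
    (Finset.univ.filter fun i : Fin (n + 1) =>
      ¬ Infers (sampleForms v (i.removeNth t)) (v (t i)) x).card ≤ 2 * d := by
  by_contra! hlt
  set bad := Finset.univ.filter fun i : Fin (n + 1) =>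
      ¬ Infers (sampleForms v (i.removeNth t)) (v (t i)) x with hbad
  have hsplit := Finset.card_filter_add_card_filter_not (s := bad)
    (fun i => 0 ≤ formVal (v (t i)) x)
  have main : ∀ B ⊆ bad, d + 1 ≤ B.card →
      ((∀ j ∈ B, 0 ≤ formVal (v (t j)) x) ∨ ∀ j ∈ B, ¬ 0 ≤ formVal (v (t j)) x) → False := by
    intro B hB hcard hsign
    obtain ⟨A, hAB, hA⟩ := Finset.exists_subset_card_eq hcard
    obtain ⟨g, hg, hinf⟩ := exists_infers_erase d hd (fun j => v (t j)) (fun j i => hv _ i) x A hA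
      (hsign.imp (fun h j hj => h j (hAB hj)) fun h j hj => h j (hAB hj))
    have hgbad := hB (hAB hg)
    rw [hbad, Finset.mem_filter] at hgbad
    refine hgbad.2 (hinf.mono (Set.insert_subset_insert ?_))
    rintro _ ⟨j, ⟨-, hj⟩, rfl⟩
    obtain ⟨i, rfl⟩ := Fin.exists_succAbove_eq hj
    exact ⟨i, rfl⟩
  by_cases hcase : d + 1 ≤ (bad.filter fun i => 0 ≤ formVal (v (t i)) x).card
  · exact main _ (Finset.filter_subset _ _) hcase
      (Or.inl fun j hj => (Finset.mem_filter.1 hj).2)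
  · refine main (bad.filter fun i => ¬ 0 ≤ formVal (v (t i)) x) (Finset.filter_subset _ _)
      (by omega) (Or.inr fun j hj => (Finset.mem_filter.1 hj).2)

end Inference

section Counting

/-- The number of subsets of size at most `k` of an `f`-element set is at most `(f + 1) ^ k`. -/
theorem card_filter_card_le {α : Type} [DecidableEq α] (F : Finset α) (k : ℕ) :
    (F.powerset.filter fun T => T.card ≤ k).card ≤ (F.card + 1) ^ k := by
  have hsub : (F.powerset.filter fun T => T.card ≤ k) ⊆
      (Finset.range (k + 1)).biUnion fun i => F.powersetCard i := by
    intro T hT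
    rw [Finset.mem_filter, Finset.mem_powerset] at hT
    exact Finset.mem_biUnion.2 ⟨T.card, Finset.mem_range.2 (by omega),
      Finset.mem_powersetCard.2 ⟨hT.1, rfl⟩⟩
  calc (F.powerset.filter fun T => T.card ≤ k).card
      ≤ ∑ i ∈ Finset.range (k + 1), (F.powersetCard i).card :=
        (Finset.card_le_card hsub).trans Finset.card_biUnion_le
    _ ≤ ∑ i ∈ Finset.range (k + 1), F.card ^ i * 1 ^ (k - i) * k.choose i := by
        refine Finset.sum_le_sum fun i hi => ?_
        rw [Finset.card_powersetCard, one_pow, mul_one]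
        refine (Nat.choose_le_pow _ _).trans (Nat.le_mul_of_pos_right _ (Nat.choose_pos ?_))
        rw [Finset.mem_range] at hi
        omega
    _ = (F.card + 1) ^ k := (add_pow _ _ _).symm

variable {ι : Type} [Fintype ι]

/-- Comparisons realised by points of `ℝ^ι` cannot shatter more than `|ι|` pairs of forms. -/
theorem card_le_of_shatters_comparisons [DecidableEq ι]
    (𝒜 : Finset (Finset ((ι → ℤ) × (ι → ℤ)))) (T : Finset ((ι → ℤ) × (ι → ℤ)))
    (h𝒜 : ∀ U ∈ 𝒜, ∃ x, ∀ p ∈ T, p ∈ U ↔ formVal p.1 x ≤ formVal p.2 x) (hT : 𝒜.Shatters T) :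
    T.card ≤ Fintype.card ι := by
  by_contra! hlt
  let f : T → ι → ℝ := fun p i => ((p.1.2 - p.1.1) i : ℤ)
  have hdep : ¬ LinearIndependent ℝ f := by
    intro h
    have := h.fintype_card_le_finrank
    rw [Module.finrank_fintype_fun_eq_card, Fintype.card_coe] at this
    omega
  obtain ⟨c, hc, hneg⟩ : ∃ c : T → ℝ, ∑ p, c p • f p = 0 ∧ ∃ p, c p < 0 := by
    obtain ⟨c, hc, p, hp⟩ := Fintype.not_linearIndependent_iff.1 hdep
    rcases lt_or_gt_of_ne hp with h | h
    · exact ⟨c, hc, p, h⟩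
    · refine ⟨-c, ?_, p, by simpa using h⟩
      simp only [Pi.neg_apply, neg_smul, Finset.sum_neg_distrib, hc, neg_zero]
  obtain ⟨U, hU, hTU⟩ := hT (t := (Finset.univ.filter fun p : T => 0 ≤ c p).image Subtype.val) (by
    intro p hp
    obtain ⟨q, -, rfl⟩ := Finset.mem_image.1 hp
    exact q.2)
  obtain ⟨x, hx⟩ := h𝒜 U hU
  have hiff : ∀ p : T, 0 ≤ c p ↔ formVal p.1.1 x ≤ formVal p.1.2 x := by
    intro p
    rw [← hx p.1 p.2]
    have : p.1 ∈ T ∩ U ↔ 0 ≤ c p := by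
      rw [hTU]
      simp
    rw [← this, Finset.mem_inter, and_iff_right p.2]
  have hzero : ∑ p : T, c p * (formVal p.1.2 x - formVal p.1.1 x) = 0 := by
    have h : ∑ i, (∑ p, c p • f p) i * x i = 0 := by
      rw [hc]
      simp
    rw [← h]
    simp only [Finset.sum_apply, Finset.sum_mul, Pi.smul_apply, smul_eq_mul]
    rw [Finset.sum_comm]
    refine Finset.sum_congr rfl fun p _ => ?_
    rw [← formVal_sub, formVal, Finset.mul_sum]
    simp only [f, mul_assoc]
  obtain ⟨p₀, hp₀⟩ := hneg
  refine absurd hzero (ne_of_gt (Finset.sum_pos' (fun p _ => ?_) ⟨p₀, Finset.mem_univ _, ?_⟩))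
  · by_cases h : 0 ≤ c p
    · exact mul_nonneg h (sub_nonneg.2 ((hiff p).1 h))
    · exact mul_nonneg_of_nonpos_of_nonpos (not_le.1 h).le
        (sub_nonpos.2 (not_le.1 (mt (hiff p).2 h)).le)
  · exact mul_pos_of_neg_of_neg hp₀ (sub_neg.2 (not_le.1 (mt (hiff p₀).2 (not_le.2 hp₀))))

/-- Few points suffice to represent all orders of the values of finitely many forms. -/
theorem exists_representatives (L : Finset (ι → ℤ)) :
    ∃ Γ : Finset (ι → ℝ), Γ.card ≤ (L.card ^ 2 + 1) ^ Fintype.card ι ∧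
      ∀ x, ∃ y ∈ Γ, Agree (L : Set (ι → ℤ)) x y := by
  classical
  let pat : (ι → ℝ) → Finset ((ι → ℤ) × (ι → ℤ)) := fun x =>
    (L ×ˢ L).filter fun p => formVal p.1 x ≤ formVal p.2 x
  let 𝒜 := (L ×ˢ L).powerset.filter fun U => ∃ x, pat x = U
  have hpat : ∀ x, pat x ∈ 𝒜 := fun x =>
    Finset.mem_filter.2 ⟨Finset.mem_powerset.2 (Finset.filter_subset _ _), x, rfl⟩
  have hrep : ∀ U, ∃ x, U ∈ 𝒜 → pat x = U := fun U => by
    by_cases hU : U ∈ 𝒜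
    · obtain ⟨x, hx⟩ := (Finset.mem_filter.1 hU).2
      exact ⟨x, fun _ => hx⟩
    · exact ⟨0, fun h => absurd h hU⟩
  choose rep hrep using hrep
  refine ⟨𝒜.image rep, Finset.card_image_le.trans ?_, fun x =>
    ⟨_, Finset.mem_image_of_mem rep (hpat x), fun g hg h hh => ?_⟩⟩
  · have hsub : 𝒜.shatterer ⊆ (L ×ˢ L).powerset.filter fun T => T.card ≤ Fintype.card ι := by
      intro T hT
      have hT := Finset.mem_shatterer.1 hT
      obtain ⟨U, hU, hTU⟩ := hT.exists_superset
      have hTL : T ⊆ L ×ˢ L := hTU.trans (Finset.mem_powerset.1 (Finset.mem_filter.1 hU).1)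
      refine Finset.mem_filter.2 ⟨Finset.mem_powerset.2 hTL,
        card_le_of_shatters_comparisons 𝒜 T (fun V hV => ?_) hT⟩
      obtain ⟨x, rfl⟩ := (Finset.mem_filter.1 hV).2
      exact ⟨x, fun p hp => by simp only [pat, Finset.mem_filter, and_iff_right (hTL hp)]⟩
    calc 𝒜.card ≤ 𝒜.shatterer.card := Finset.card_le_card_shatterer 𝒜
      _ ≤ _ := Finset.card_le_card hsub
      _ ≤ ((L ×ˢ L).card + 1) ^ Fintype.card ι := card_filter_card_le _ _
      _ = (L.card ^ 2 + 1) ^ Fintype.card ι := by rw [Finset.card_product, sq]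
  · have h1 := Finset.ext_iff.1 (hrep _ (hpat x)) (g, h)
    simp only [pat, Finset.mem_filter, Finset.mem_product] at h1
    have hg' : g ∈ L := hg
    have hh' : h ∈ L := hh
    simpa [hg', hh'] using h1.symm

end Counting

section Sorting

/-- A nonempty finite set that is totally preordered by `r` has a least element. -/
theorem exists_least_of_total {α : Type} (r : α → α → Prop)
    (htrans : ∀ a b c, r a b → r b c → r a c) {s : Set α} (hs : s.Finite) (hne : s.Nonempty)
    (htot : ∀ a ∈ s, ∀ b ∈ s, r a b ∨ r b a) : ∃ a ∈ s, ∀ b ∈ s, r a b := by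
  induction s, hs using Set.Finite.induction_on with
  | empty => exact absurd hne Set.not_nonempty_empty
  | @insert c t _ _ ih =>
    have hcc : r c c := (htot c (Or.inl rfl) c (Or.inl rfl)).elim id id
    rcases t.eq_empty_or_nonempty with rfl | hne'
    · refine ⟨c, Or.inl rfl, ?_⟩
      rintro b (rfl | hb)
      · exact hcc
      · exact absurd hb (Set.notMem_empty b)
    · obtain ⟨a, ha, hmin⟩ := ih hne' fun a ha b hb => htot a (Or.inr ha) b (Or.inr hb)
      rcases htot a (Or.inr ha) c (Or.inl rfl) with h | h
      · refine ⟨a, Or.inr ha, ?_⟩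
        rintro b (rfl | hb)
        · exact h
        · exact hmin b hb
      · refine ⟨c, Or.inl rfl, ?_⟩
        rintro b (rfl | hb)
        · exact hcc
        · exact htrans _ _ _ h (hmin b hb)

open Classical in
/-- In a finite chain of predicates, two predicates split a finite set into two parts of at most
half the size and a middle part on which all predicates of the chain are constant. -/
theorem exists_median_predicates {X : Type} (R : Set X) (Q : Set (X → Prop)) (hQ : Q.Finite)
    (htrue : (fun _ => True) ∈ Q) (hfalse : (fun _ => False) ∈ Q)
    (htot : ∀ p ∈ Q, ∀ q ∈ Q, (∀ x ∈ R, p x → q x) ∨ ∀ x ∈ R, q x → p x)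
    (Γ : Finset X) (m : ℕ) (hΓ : Γ.card ≤ 2 * m) :
    ∃ p ∈ Q, ∃ p' ∈ Q, (Γ.filter fun x => ¬ p x).card ≤ m ∧ (Γ.filter fun x => p' x).card ≤ m ∧
      ∀ q ∈ Q, (∀ x ∈ R, p x → q x) ∨ ∀ x ∈ R, q x → p' x := by
  obtain ⟨p, hp, hpmin⟩ := exists_least_of_total
    (fun p q : X → Prop => ∀ x ∈ R, p x → q x) (fun a b c h h' x hx ha => h' x hx (h x hx ha))
    (s := {p | p ∈ Q ∧ (Γ.filter fun x => ¬ p x).card ≤ m}) (hQ.subset fun _ h => h.1)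
    ⟨_, htrue, by simp⟩ (fun a ha b hb => htot a ha.1 b hb.1)
  obtain ⟨p', hp', hpmax⟩ := exists_least_of_total
    (fun p q : X → Prop => ∀ x ∈ R, q x → p x) (fun a b c h h' x hx hc => h x hx (h' x hx hc))
    (s := {p | p ∈ Q ∧ (Γ.filter fun x => p x).card ≤ m}) (hQ.subset fun _ h => h.1)
    ⟨_, hfalse, by simp⟩ (fun a ha b hb => (htot a ha.1 b hb.1).symm)
  refine ⟨p, hp.1, p', hp'.1, hp.2, hp'.2, fun q hq => ?_⟩
  have := Finset.card_filter_add_card_filter_not (s := Γ) (fun x => q x)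
  by_cases h : (Γ.filter fun x => q x).card ≤ m
  · exact Or.inr (hpmax q ⟨hq, h⟩)
  · exact Or.inl (hpmin q ⟨hq, by omega⟩)

variable {ι : Type} [Fintype ι]

/-- A tree with at most one query, with small coefficients, decides the predicate `p`. -/
def Decidable1 (p : (ι → ℝ) → Prop) : Prop :=
  ∃ T : LDT ι Bool, T.depth ≤ 1 ∧ T.SmallCoeffs ∧ ∀ x, T.eval x = true ↔ p x

theorem decidable1_le (u v : ι → ℤ) (h : ∀ i, (v - u) i ∈ ({-2, -1, 0, 1, 2} : Set ℤ)) :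
    Decidable1 fun x => formVal u x ≤ formVal v x := by
  refine ⟨.node (v - u) 0 (.leaf true) (.leaf false), by simp [LDT.depth],
    ⟨h, trivial, trivial⟩, fun x => ?_⟩
  change (if 0 ≤ formVal (v - u) x then true else false) = true ↔ _
  simp [formVal_sub]

theorem decidable1_lt (u v : ι → ℤ) (h : ∀ i, (u - v) i ∈ ({-2, -1, 0, 1, 2} : Set ℤ)) :
    Decidable1 fun x => formVal u x < formVal v x := by
  refine ⟨.node (u - v) 0 (.leaf false) (.leaf true), by simp [LDT.depth],
    ⟨h, trivial, trivial⟩, fun x => ?_⟩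
  change (if 0 ≤ formVal (u - v) x then false else true) = true ↔ _
  simp [formVal_sub]

/-- The comparisons of `b` with the elements of `A`, as predicates of the input, together with the
two constant predicates. -/
def insertionPredicates (A : Set (ι → ℤ)) (b : ι → ℤ) : Set ((ι → ℝ) → Prop) :=
  insert (fun _ => True) (insert (fun _ => False)
    ((fun a x => formVal a x ≤ formVal b x) '' A ∪ (fun a x => formVal a x < formVal b x) '' A))

theorem insertionPredicates_total (A : Set (ι → ℤ)) (b : ι → ℤ) (x₀ : ι → ℝ) :
    ∀ p ∈ insertionPredicates A b, ∀ q ∈ insertionPredicates A b,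
      (∀ x ∈ {x | Agree A x x₀}, p x → q x) ∨ ∀ x ∈ {x | Agree A x x₀}, q x → p x := by
  have hle : ∀ a ∈ A, ∀ a' ∈ A, (∀ x ∈ {x | Agree A x x₀}, formVal a x ≤ formVal a' x) ∨
      ∀ x ∈ {x | Agree A x x₀}, formVal a' x < formVal a x := by
    intro a ha a' ha'
    by_cases h : formVal a x₀ ≤ formVal a' x₀
    · exact Or.inl fun x hx => (hx a ha a' ha').2 h
    · exact Or.inr fun x hx => not_le.1 (mt (hx a ha a' ha').1 h)
  rintro p (rfl | rfl | ⟨a, ha, rfl⟩ | ⟨a, ha, rfl⟩) q (rfl | rfl | ⟨a', ha', rfl⟩ | ⟨a', ha', rfl⟩)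
  all_goals try simp
  · rcases hle a ha a' ha' with h | h
    · exact Or.inr fun x hx hq => (h x hx).trans hq
    · exact Or.inl fun x hx hq => (h x hx).le.trans hq
  · rcases hle a ha a' ha' with h | h
    · exact Or.inr fun x hx hq => (h x hx).trans hq.le
    · exact Or.inl fun x hx hq => (h x hx).trans_le hq
  · rcases hle a' ha' a ha with h | h
    · exact Or.inl fun x hx hq => (h x hx).trans hq.le
    · exact Or.inr fun x hx hq => (h x hx).trans_le hq
  · rcases hle a ha a' ha' with h | h
    · exact Or.inr fun x hx hq => (h x hx).trans_lt hq
    · exact Or.inl fun x hx hq => (h x hx).trans hq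

theorem agree_insert_of_insertionPredicates (A : Set (ι → ℤ)) (b : ι → ℤ) {x y : ι → ℝ}
    (hxy : Agree A x y) (h : ∀ q ∈ insertionPredicates A b, q x ↔ q y) :
    Agree (insert b A) x y := by
  have hle : ∀ a ∈ A, formVal a x ≤ formVal b x ↔ formVal a y ≤ formVal b y := fun a ha =>
    h _ (Or.inr (Or.inr (Or.inl ⟨a, ha, rfl⟩)))
  have hlt : ∀ a ∈ A, formVal a x < formVal b x ↔ formVal a y < formVal b y := fun a ha =>
    h _ (Or.inr (Or.inr (Or.inr ⟨a, ha, rfl⟩)))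
  rintro g (rfl | hg) g' (rfl | hg')
  · simp
  · rw [← not_lt, ← not_lt, hlt g' hg']
  · exact hle g hg
  · exact hxy g hg g' hg'

theorem insertionPredicates_congr (A : Set (ι → ℤ)) (b : ι → ℤ) {x y : ι → ℝ}
    (hxy : Agree (insert b A) x y) : ∀ q ∈ insertionPredicates A b, q x ↔ q y := by
  rintro q (rfl | rfl | ⟨a, ha, rfl⟩ | ⟨a, ha, rfl⟩)
  · rfl
  · rfl
  · exact hxy a (Or.inr ha) b (Or.inl rfl)
  · simp only [← not_le]
    exact not_congr (hxy b (Or.inl rfl) a (Or.inr ha))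

theorem insertionPredicates_decidable1 (A : Set (ι → ℤ)) (b : ι → ℤ)
    (h : ∀ a ∈ A, ∀ i, (b - a) i ∈ ({-2, -1, 0, 1, 2} : Set ℤ) ∧
      (a - b) i ∈ ({-2, -1, 0, 1, 2} : Set ℤ)) :
    ∀ q ∈ insertionPredicates A b, Decidable1 q := by
  rintro q (rfl | rfl | ⟨a, ha, rfl⟩ | ⟨a, ha, rfl⟩)
  · exact ⟨.leaf true, by simp [LDT.depth], trivial, fun x => by simp [LDT.eval]⟩
  · exact ⟨.leaf false, by simp [LDT.depth], trivial, fun x => by simp [LDT.eval]⟩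
  · exact decidable1_le a b fun i => (h a ha i).1
  · exact decidable1_lt a b fun i => (h a ha i).2

/-- Fredman's sorting with partial information: if the order of the forms in `A` is known and at
most `2 ^ e` orders are possible, the forms in `B` are inserted with `2 * (e + |B|)` queries. -/
theorem exists_sorting_tree_of_candidates (B : List (ι → ℤ)) :
    ∀ (e : ℕ) (A : Set (ι → ℤ)) (Γ : Finset (ι → ℝ)), A.Finite → Γ.card ≤ 2 ^ e →
      (∀ x ∈ Γ, ∀ y ∈ Γ, Agree A x y) →
      (∀ u ∈ A ∪ {w | w ∈ B}, ∀ v ∈ A ∪ {w | w ∈ B}, ∀ i,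
        (u - v) i ∈ ({-2, -1, 0, 1, 2} : Set ℤ)) →
      ∃ T : LDT ι (ι → ℝ), T.depth ≤ 2 * (e + B.length) ∧ T.SmallCoeffs ∧
        ∀ x, (∃ y ∈ Γ, Agree (A ∪ {w | w ∈ B}) x y) →
          Agree (A ∪ {w | w ∈ B}) x (T.eval x) := by
  classical
  induction B with
  | nil =>
    intro e A Γ _ _ hΓ _
    rcases Γ.eq_empty_or_nonempty with rfl | ⟨x₀, hx₀⟩
    · exact ⟨.leaf 0, by simp [LDT.depth], trivial, by simp⟩
    · refine ⟨.leaf x₀, by simp [LDT.depth], trivial, ?_⟩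
      rintro x ⟨y, hy, hxy⟩
      simp only [List.not_mem_nil, Set.ofPred_false, Set.union_empty] at hxy ⊢
      exact hxy.trans (hΓ y hy x₀ hx₀)
  | cons b B ih =>
    intro e A Γ hA hcard hΓ hsmall
    induction e generalizing Γ with
    | zero =>
      rcases Γ.eq_empty_or_nonempty with rfl | ⟨x₀, hx₀⟩
      · exact ⟨.leaf 0, by simp [LDT.depth], trivial, by simp⟩
      · refine ⟨.leaf x₀, by simp [LDT.depth], trivial, ?_⟩
        rintro x ⟨y, hy, hxy⟩
        rwa [Finset.card_le_one.1 (by simpa using hcard) y hy x₀ hx₀] at hxy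
    | succ e ihe =>
      rcases Γ.eq_empty_or_nonempty with rfl | ⟨x₀, hx₀⟩
      · exact ⟨.leaf 0, by simp [LDT.depth], trivial, by simp⟩
      have hset : A ∪ {w | w ∈ b :: B} = insert b A ∪ {w | w ∈ B} := by
        ext w
        simp only [Set.mem_union, Set.mem_ofPred_eq, List.mem_cons, Set.mem_insert_iff]
        tauto
      have hQfin : (insertionPredicates A b).Finite :=
        (((hA.image _).union (hA.image _)).insert _).insert _
      obtain ⟨p, hp, p', hp', hpm, hpm', hmid⟩ := exists_median_predicates {x | Agree A x x₀}
        (insertionPredicates A b) hQfin (Or.inl rfl) (Or.inr (Or.inl rfl))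
        (insertionPredicates_total A b x₀) Γ (2 ^ e) (by rw [pow_succ] at hcard; omega)
      have hdec := insertionPredicates_decidable1 A b fun a ha i =>
        ⟨hsmall b (by simp) a (Or.inl ha) i, hsmall a (Or.inl ha) b (by simp) i⟩
      obtain ⟨T, hTd, hTs, hT⟩ := hdec p hp
      obtain ⟨T', hTd', hTs', hT'⟩ := hdec p' hp'
      have hsub : ∀ Δ ⊆ Γ, ∀ x ∈ Δ, ∀ y ∈ Δ, Agree A x y :=
        fun Δ hΔ x hx y hy => hΓ x (hΔ hx) y (hΔ hy)
      obtain ⟨T₁, hd₁, hs₁, h₁⟩ := ihe (Γ.filter fun x => ¬ p x) hpm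
        (hsub _ (Finset.filter_subset _ _))
      obtain ⟨T₂, hd₂, hs₂, h₂⟩ := ihe (Γ.filter fun x => p' x) hpm'
        (hsub _ (Finset.filter_subset _ _))
      have hmidΓ : ∀ x ∈ Γ.filter (fun x => p x ∧ ¬ p' x),
          ∀ y ∈ Γ.filter (fun x => p x ∧ ¬ p' x), Agree (insert b A) x y := by
        intro x hx y hy
        rw [Finset.mem_filter] at hx hy
        refine agree_insert_of_insertionPredicates A b (hΓ x hx.1 y hy.1) fun q hq => ?_
        rcases hmid q hq with h | h
        · exact iff_of_true (h x (hΓ x hx.1 x₀ hx₀) hx.2.1) (h y (hΓ y hy.1 x₀ hx₀) hy.2.1)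
        · exact iff_of_false (mt (h x (hΓ x hx.1 x₀ hx₀)) hx.2.2)
            (mt (h y (hΓ y hy.1 x₀ hx₀)) hy.2.2)
      obtain ⟨T₃, hd₃, hs₃, h₃⟩ := ih (e + 1) (insert b A) (Γ.filter fun x => p x ∧ ¬ p' x)
        (hA.insert b) ((Finset.card_filter_le _ _).trans hcard) hmidΓ (by rwa [← hset])
      refine ⟨T.bind fun t => if t then T'.bind fun t' => if t' then T₂ else T₃ else T₁,
        ?_, ?_, ?_⟩
      · have inner : ∀ t' : Bool, (if t' then T₂ else T₃).depth ≤ 2 * (e + 1 + B.length) := by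
          intro t'
          simp only [List.length_cons] at hd₂
          split_ifs <;> omega
        have outer : ∀ t : Bool,
            (if t then T'.bind fun t' => if t' then T₂ else T₃ else T₁).depth ≤
              1 + 2 * (e + 1 + B.length) := by
          intro t
          have := LDT.depth_bind_le T' inner
          simp only [List.length_cons] at hd₁
          split_ifs <;> omega
        have := LDT.depth_bind_le T outer
        simp only [List.length_cons]
        omega
      · refine hTs.bind fun t => ?_
        split_ifs
        · refine hTs'.bind fun t' => ?_
          split_ifs
          exacts [hs₂, hs₃]
        · exact hs₁
      · rintro x ⟨y, hy, hxy⟩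
        have hcongr := insertionPredicates_congr A b
          (hxy.mono (by rw [hset]; exact Set.subset_union_left))
        rw [LDT.eval_bind]
        by_cases hpx : p x
        · rw [if_pos ((hT x).2 hpx), LDT.eval_bind]
          by_cases hpx' : p' x
          · rw [if_pos ((hT' x).2 hpx')]
            exact h₂ x ⟨y, Finset.mem_filter.2 ⟨hy, (hcongr p' hp').1 hpx'⟩, hxy⟩
          · rw [if_neg (mt (hT' x).1 hpx'), hset]
            rw [hset] at hxy
            exact h₃ x ⟨y, Finset.mem_filter.2
              ⟨hy, (hcongr p hp).1 hpx, mt (hcongr p' hp').2 hpx'⟩, hxy⟩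
        · rw [if_neg (mt (hT x).1 hpx)]
          exact h₁ x ⟨y, Finset.mem_filter.2 ⟨hy, mt (hcongr p hp).2 hpx⟩, hxy⟩

/-- A small sample of bounded forms can be sorted with few queries. -/
theorem exists_sorting_tree {β : Type} (v : β → ι → ℤ) (hv : ∀ b i, |v b i| ≤ 1) {n : ℕ} (e : ℕ)
    (he : ((n + 1) ^ 2 + 1) ^ Fintype.card ι ≤ 2 ^ e) (s : Fin n → β) :
    ∃ T : LDT ι (ι → ℝ), T.depth ≤ 2 * (e + (n + 1)) ∧ T.SmallCoeffs ∧
      ∀ x, Agree (sampleForms v s) x (T.eval x) := by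
  classical
  let B : List (ι → ℤ) := 0 :: List.ofFn fun i => v (s i)
  have hB : ∅ ∪ {w | w ∈ B} = sampleForms v s := by
    ext w
    simp [B, sampleForms, List.mem_ofFn]
  have hlen : B.length = n + 1 := by simp [B]
  obtain ⟨Γ, hΓ, hrep⟩ := exists_representatives B.toFinset
  have hcard : B.toFinset.card ≤ n + 1 := (List.toFinset_card_le B).trans_eq hlen
  obtain ⟨T, hd, hs, hT⟩ := exists_sorting_tree_of_candidates B e ∅ Γ Set.finite_empty
    (hΓ.trans (le_trans (by gcongr) he)) (fun x _ y _ g hg => absurd hg (Set.notMem_empty g)) (by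
      rw [hB]
      have hb : ∀ u ∈ sampleForms v s, ∀ i, |u i| ≤ 1 := by
        rintro u (rfl | ⟨j, rfl⟩) i
        · simp
        · exact hv _ i
      intro u hu w hw i
      have h1 := abs_le.1 (hb u hu i)
      have h2 := abs_le.1 (hb w hw i)
      simp only [Pi.sub_apply, Set.mem_insert_iff, Set.mem_singleton_iff]
      omega)
  rw [hlen] at hd
  rw [hB] at hT
  refine ⟨T, hd, hs, fun x => hT x ?_⟩
  obtain ⟨y, hy, hxy⟩ := hrep x
  refine ⟨y, hy, hxy.mono (fun w hw => ?_)⟩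
  rw [← hB] at hw
  simpa using hw

end Sorting

section RandomTrees

variable {ι : Type} [Fintype ι]

open Classical in
/-- On average over a random sample, at least half of the forms are inferred. -/
theorem two_mul_sum_card_not_infers_le {α : Type} [Fintype α] (v : α → ι → ℤ)
    (hv : ∀ b i, |v b i| ≤ 1) (d : ℕ) (hd : (4 * d + 1) ^ Fintype.card ι < 2 ^ d) (n : ℕ)
    (hn : 4 * d ≤ n + 1) (x : ι → ℝ) :
    2 * ∑ s : Fin n → α,
        (Finset.univ.filter fun h : α => ¬ Infers (sampleForms v s) (v h) x).card ≤
      Fintype.card α ^ n * Fintype.card α := by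
  set X := ∑ s : Fin n → α,
    (Finset.univ.filter fun h : α => ¬ Infers (sampleForms v s) (v h) x).card with hX
  have hi : ∀ i : Fin (n + 1), (∑ t : Fin (n + 1) → α,
      if ¬ Infers (sampleForms v (i.removeNth t)) (v (t i)) x then 1 else 0) = X := by
    intro i
    refine (Fintype.sum_equiv (Fin.insertNthEquiv (fun _ => α) i).symm _
      (fun p : α × (Fin n → α) => if ¬ Infers (sampleForms v p.2) (v p.1) x then 1 else 0)
      (fun t => rfl)).trans ?_
    rw [Fintype.sum_prod_type_right, hX]
    exact Finset.sum_congr rfl fun s _ => (Finset.card_filter _ _).symm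
  have hsum : (n + 1) * X ≤ Fintype.card α ^ (n + 1) * (2 * d) :=
    calc (n + 1) * X = ∑ i : Fin (n + 1), ∑ t : Fin (n + 1) → α,
          if ¬ Infers (sampleForms v (i.removeNth t)) (v (t i)) x then 1 else 0 := by
          simp only [hi, Finset.sum_const, Finset.card_univ, Fintype.card_fin, smul_eq_mul]
      _ = ∑ t : Fin (n + 1) → α, (Finset.univ.filter fun i : Fin (n + 1) =>
          ¬ Infers (sampleForms v (i.removeNth t)) (v (t i)) x).card := by
          rw [Finset.sum_comm]
          exact Finset.sum_congr rfl fun t _ => (Finset.card_filter _ _).symm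
      _ ≤ ∑ _t : Fin (n + 1) → α, 2 * d :=
          Finset.sum_le_sum fun t _ => card_not_infers_removeNth_le v hv d hd t x
      _ = Fintype.card α ^ (n + 1) * (2 * d) := by simp
  refine Nat.le_of_mul_le_mul_left ?_ (Nat.succ_pos n)
  calc (n + 1) * (2 * X) = 2 * ((n + 1) * X) := by ring
    _ ≤ 2 * (Fintype.card α ^ (n + 1) * (2 * d)) := by gcongr
    _ = Fintype.card α ^ (n + 1) * (4 * d) := by ring
    _ ≤ Fintype.card α ^ (n + 1) * (n + 1) := by gcongr
    _ = (n + 1) * (Fintype.card α ^ n * Fintype.card α) := by ring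

/-- The coordinates of a uniformly random element of a product are uniformly distributed. -/
theorem sum_apply_mul_card {α : Type} [Fintype α] [DecidableEq α] (β : α → Type)
    [∀ a, Fintype (β a)] (a : α) (f : β a → ℕ) :
    (∑ ω : ∀ a, β a, f (ω a)) * Fintype.card (β a) =
      Fintype.card (∀ a, β a) * ∑ b, f b := by
  have hsplit : ∑ ω : ∀ a, β a, f (ω a) =
      ∑ p : β a × ∀ j : { j // j ≠ a }, β j, f p.1 :=
    Fintype.sum_equiv (Equiv.piSplitAt a β) _ _ fun ω => rfl
  rw [hsplit, Fintype.sum_prod_type, Fintype.card_congr (Equiv.piSplitAt a β), Fintype.card_prod]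
  simp only [Finset.sum_const, Finset.card_univ, smul_eq_mul, ← Finset.mul_sum]
  ring

open Classical in
/-- A finite family of trees that determine the forms of a family that are negative at the input:
after `R` rounds, a random tree of the family fails with small probability. -/
theorem exists_random_sign_trees {β : Type} [Fintype β] (v : β → ι → ℤ)
    (hv : ∀ b i, |v b i| ≤ 1) (d : ℕ) (hd : (4 * d + 1) ^ Fintype.card ι < 2 ^ d) (n : ℕ)
    (hn : 4 * d ≤ n + 1) (K : ℕ)
    (htree : ∀ s : Fin n → β, ∃ T : LDT ι (ι → ℝ), T.depth ≤ K ∧ T.SmallCoeffs ∧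
      ∀ x, Agree (sampleForms v s) x (T.eval x)) (R : ℕ) :
    ∃ (Ω : Type) (_ : Fintype Ω) (_ : Nonempty Ω)
      (T : Ω → Finset β → LDT ι (Option (Finset β))),
      (∀ ω A, (T ω A).depth ≤ R * K ∧ (T ω A).SmallCoeffs ∧ ∀ x, (T ω A).eval x = none ∨
        (T ω A).eval x = some (A.filter fun b => formVal (v b) x < 0)) ∧
      ∀ A x, 2 ^ R * (Finset.univ.filter fun ω => (T ω A).eval x = none).card ≤
        A.card * Fintype.card Ω := by
  induction R with
  | zero =>
    refine ⟨Unit, inferInstance, inferInstance,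
      fun _ A => if A = ∅ then .leaf (some ∅) else .leaf none, fun _ A => ?_, fun A x => ?_⟩
    · by_cases hA : A = ∅
      · simp [hA, LDT.depth, LDT.SmallCoeffs, LDT.eval]
      · simp [hA, LDT.depth, LDT.SmallCoeffs, LDT.eval]
    · by_cases hA : A = ∅
      · simp [hA, LDT.eval]
      · have : 1 ≤ A.card := Finset.card_pos.2 (Finset.nonempty_iff_ne_empty.2 hA)
        simpa [hA, LDT.eval] using this
  | succ R ih =>
    obtain ⟨Ω, _, _, T, hT, hfail⟩ := ih
    choose sortTree hsd hss hse using htree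
    let rem : (Fin n → β) → (ι → ℝ) → Finset β → Finset β := fun s x A =>
      A.filter fun h => ¬ Infers (sampleForms v s) (v h) x
    let neg : (Fin n → β) → (ι → ℝ) → Finset β → Finset β := fun s x A =>
      A.filter fun h => Infers (sampleForms v s) (v h) x ∧ formVal (v h) x < 0
    have hrem : ∀ s x A, rem s ((sortTree s).eval x) A = rem s x A := fun s x A =>
      Finset.filter_congr fun h _ => not_congr (infers_iff_of_agree (hse s x)).symm
    have hneg : ∀ s x A, neg s ((sortTree s).eval x) A = neg s x A := fun s x A =>
      Finset.filter_congr fun h _ => by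
        rw [← infers_iff_of_agree (hse s x)]
        refine and_congr_right fun hinf => ?_
        rw [← not_le, ← not_le, hinf _ (hse s x)]
    let Sample : {A : Finset β // A.Nonempty} → Type := fun A => Fin n → {b // b ∈ A.1}
    have hne : ∀ A, Nonempty (Sample A) := fun A =>
      ⟨fun _ => ⟨A.2.choose, A.2.choose_spec⟩⟩
    let sam : (∀ A, Sample A) → ∀ A : Finset β, A.Nonempty → Fin n → β :=
      fun σ A hA i => (σ ⟨A, hA⟩ i).1
    let step : (Fin n → β) → Ω → Finset β → LDT ι (Option (Finset β)) := fun s ω A =>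
      (sortTree s).bind fun y => (T ω (rem s y A)).bind fun o =>
        .leaf (o.map fun B => B ∪ neg s y A)
    have hstep : ∀ s ω A x, (step s ω A).eval x =
        ((T ω (rem s x A)).eval x).map fun B => B ∪ neg s x A := by
      intro s ω A x
      simp only [step, LDT.eval_bind, hrem, hneg, LDT.eval]
    refine ⟨(∀ A, Sample A) × Ω, inferInstance, inferInstance, fun ω A =>
      if hA : A.Nonempty then step (sam ω.1 A hA) ω.2 A else .leaf (some ∅),
      fun ω A => ?_, fun A x => ?_⟩
    · by_cases hA : A.Nonempty
      · simp only [hA, dif_pos]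
        refine ⟨?_, ?_, fun x => ?_⟩
        · have h1 : ∀ y, ((T ω.2 (rem (sam ω.1 A hA) y A)).bind fun o =>
              (.leaf (o.map fun B => B ∪ neg (sam ω.1 A hA) y A) :
                LDT ι (Option (Finset β)))).depth ≤ R * K + 0 := fun y =>
            (LDT.depth_bind_le (K := 0) _ fun o => by simp [LDT.depth]).trans
              (Nat.add_le_add_right (hT _ _).1 0)
          refine (LDT.depth_bind_le _ h1).trans ?_
          have := hsd (sam ω.1 A hA)
          rw [add_mul]
          omega
        · exact (hss _).bind fun y => (hT _ _).2.1.bind fun o => trivial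
        · rw [hstep]
          refine ((hT ω.2 (rem (sam ω.1 A hA) x A)).2.2 x).imp (fun h => by rw [h]; rfl)
            fun h => ?_
          rw [h, Option.map_some]
          congr 1
          ext b
          simp only [rem, neg, Finset.mem_union, Finset.mem_filter]
          by_cases hinf : Infers (sampleForms v (sam ω.1 A hA)) (v b) x <;> simp [hinf]
      · rw [Finset.not_nonempty_iff_eq_empty.1 hA]
        simp [LDT.depth, LDT.SmallCoeffs, LDT.eval]
    · by_cases hA : A.Nonempty
      · simp only [hA, dif_pos, hstep, Option.map_eq_none_iff]
        have hprod : (Finset.univ.filter fun ω : (∀ A, Sample A) × Ω =>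
            (T ω.2 (rem (sam ω.1 A hA) x A)).eval x = none).card =
            ∑ σ : ∀ A, Sample A, (Finset.univ.filter fun ω : Ω =>
              (T ω (rem (sam σ A hA) x A)).eval x = none).card := by
          simp only [Finset.card_filter, Fintype.sum_prod_type]
        have hmarg := sum_apply_mul_card Sample ⟨A, hA⟩
          (fun s => (rem (fun i => (s i).1) x A).card)
        have hone := two_mul_sum_card_not_infers_le (fun b : {b // b ∈ A} => v b.1)
          (fun b i => hv b.1 i) d hd n hn x
        have hremcard : ∀ s : Fin n → {b // b ∈ A}, (rem (fun i => (s i).1) x A).card =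
            (Finset.univ.filter fun h : {b // b ∈ A} =>
              ¬ Infers (sampleForms (fun b : {b // b ∈ A} => v b.1) s) (v h.1) x).card := by
          intro s
          rw [← Finset.card_map (Function.Embedding.subtype _)]
          congr 1
          ext b
          simp only [rem, Finset.mem_filter, Finset.mem_map, Finset.mem_univ, true_and,
            Function.Embedding.subtype_apply, Subtype.exists, exists_and_right, exists_eq_right]
          exact ⟨fun h => ⟨h.1, h.2⟩, fun ⟨h, h'⟩ => ⟨h, h'⟩⟩
        have hSamcard : Fintype.card (Sample ⟨A, hA⟩) = A.card ^ n := by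
          simp [Sample]
        rw [hSamcard] at hmarg
        simp only [hremcard] at hmarg
        rw [Fintype.card_coe] at hone
        have hhalf : 2 * ∑ σ : ∀ A, Sample A, (rem (sam σ A hA) x A).card ≤
            Fintype.card (∀ A, Sample A) * A.card := by
          refine Nat.le_of_mul_le_mul_right ?_ (pow_pos (Finset.card_pos.2 hA) n)
          have hsame : ∀ σ : ∀ A, Sample A, (rem (sam σ A hA) x A).card = _ :=
            fun σ => hremcard (σ ⟨A, hA⟩)
          simp only [hsame]
          rw [mul_assoc, hmarg]
          calc _ = Fintype.card (∀ A, Sample A) * (2 * _) := by ring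
            _ ≤ Fintype.card (∀ A, Sample A) * (A.card ^ n * A.card) :=
              Nat.mul_le_mul_left _ hone
            _ = _ := by ring
        rw [hprod, Fintype.card_prod]
        calc 2 ^ (R + 1) * ∑ σ : ∀ A, Sample A, (Finset.univ.filter fun ω : Ω =>
              (T ω (rem (sam σ A hA) x A)).eval x = none).card
            = 2 * ∑ σ : ∀ A, Sample A, 2 ^ R * (Finset.univ.filter fun ω : Ω =>
              (T ω (rem (sam σ A hA) x A)).eval x = none).card := by
              rw [← Finset.mul_sum]
              ring
          _ ≤ 2 * ∑ σ : ∀ A, Sample A, (rem (sam σ A hA) x A).card * Fintype.card Ω :=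
              Nat.mul_le_mul_left _ (Finset.sum_le_sum fun σ _ => hfail _ _)
          _ = (2 * ∑ σ : ∀ A, Sample A, (rem (sam σ A hA) x A).card) * Fintype.card Ω := by
              rw [← Finset.sum_mul]
              ring
          _ ≤ Fintype.card (∀ A, Sample A) * A.card * Fintype.card Ω :=
              Nat.mul_le_mul_right _ hhalf
          _ = _ := by ring
      · rw [Finset.not_nonempty_iff_eq_empty.1 hA]
        simp [LDT.eval]

open Classical in
/-- Run a tree computing a set on several blocks of the input and intersect the results. -/
theorem exists_intersection_tree {α β : Type} [Fintype α] [Fintype β]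
    (T : LDT ι (Option (Finset β))) (hT : T.SmallCoeffs) (A : (ι → ℝ) → Finset β)
    (hA : ∀ x, T.eval x = none ∨ T.eval x = some (A x)) (l : List α) :
    ∃ T' : LDT (α × ι) (Option (Finset β)), T'.depth ≤ l.length * T.depth ∧ T'.SmallCoeffs ∧
      ∀ z : α × ι → ℝ,
        (T'.eval z = none ∧ ∃ a ∈ l, T.eval (fun i => z (a, i)) = none) ∨
        T'.eval z =
          some (Finset.univ.filter fun b => ∀ a ∈ l, b ∈ A (fun i => z (a, i))) := by
  induction l with
  | nil => exact ⟨.leaf (some Finset.univ), by simp [LDT.depth], trivial, by simp [LDT.eval]⟩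
  | cons a l ih =>
    obtain ⟨T', hd, hs, h⟩ := ih
    refine ⟨(T.onBlock a).bind fun o => T'.bind fun o' =>
      .leaf (o.bind fun B => o'.map fun B' => B ∩ B'), ?_, ?_, fun z => ?_⟩
    · refine (LDT.depth_bind_le (K := T'.depth + 0) _ fun o =>
        LDT.depth_bind_le (K := 0) _ fun o' => by simp [LDT.depth]).trans ?_
      rw [LDT.depth_onBlock, List.length_cons, add_mul]
      omega
    · exact (hT.onBlock a).bind fun o => hs.bind fun o' => trivial
    · simp only [LDT.eval_bind, LDT.eval_onBlock, LDT.eval]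
      rcases hA (fun i => z (a, i)) with h₁ | h₁
      · exact Or.inl ⟨by simp [h₁], a, by simp, h₁⟩
      · rcases h z with ⟨h₂, a', ha', h₃⟩ | h₂
        · exact Or.inl ⟨by simp [h₁, h₂], a', by simp [ha'], h₃⟩
        · refine Or.inr ?_
          rw [h₁, h₂]
          simp only [Option.bind_some, Option.map_some, Option.some.injEq]
          ext b
          simp

open Classical in
/-- Applying `T` to every block of the input and intersecting the outputs counts the common
elements. -/
theorem exists_counting_tree {ℓ : ℕ} {β : Type} [Fintype β]
    (T : LDT ι (Option (Finset β))) (hT : T.SmallCoeffs) (A : (ι → ℝ) → Finset β)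
    (hA : ∀ x, T.eval x = none ∨ T.eval x = some (A x)) :
    ∃ T' : LDT (Fin ℓ × ι) (Option ℕ), T'.depth ≤ ℓ * T.depth ∧ T'.SmallCoeffs ∧
      ∀ z : Fin ℓ × ι → ℝ,
        (T'.eval z = none ∧ ∃ a, T.eval (fun i => z (a, i)) = none) ∨
        T'.eval z = some (Finset.univ.filter fun b => ∀ a, b ∈ A (fun i => z (a, i))).card := by
  obtain ⟨T', hd, hs, h⟩ := exists_intersection_tree T hT A hA (List.finRange ℓ)
  refine ⟨T'.bind fun o => .leaf (o.map Finset.card), ?_, hs.bind fun o => trivial, fun z => ?_⟩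
  · refine (LDT.depth_bind_le (K := 0) _ fun o => by simp [LDT.depth]).trans ?_
    simpa using hd
  · simp only [LDT.eval_bind, LDT.eval]
    rcases h z with ⟨h₁, a, -, h₂⟩ | h₁
    · exact Or.inl ⟨by simp [h₁], a, h₂⟩
    · refine Or.inr ?_
      rw [h₁]
      simp

end RandomTrees

section Parameters

theorem succ_mul_le_two_pow {N s : ℕ} (hN : N ≤ 2 ^ s) :
    4 * (8 * N * (s + 3)) + 1 ≤ 2 ^ (2 * s + 8) := by
  have h1 : s + 3 ≤ 2 ^ (s + 2) := by
    have := Nat.lt_two_pow_self (n := s)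
    rw [pow_add]
    omega
  have h2 : N * (s + 3) ≤ 2 ^ s * 2 ^ (s + 2) := Nat.mul_le_mul hN h1
  have h3 : 2 ^ s * 2 ^ (s + 2) = 2 ^ (2 * s + 2) := by ring
  have h4 : 2 ^ (2 * s + 8) = 64 * 2 ^ (2 * s + 2) := by ring
  have h5 : 1 ≤ 2 ^ (2 * s + 2) := Nat.one_le_two_pow
  have h6 : 4 * (8 * N * (s + 3)) = 32 * (N * (s + 3)) := by ring
  omega

theorem pow_lt_two_pow_of_le {N s : ℕ} (hN : N ≤ 2 ^ s) (hN0 : 0 < N) :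
    (4 * (8 * N * (s + 3)) + 1) ^ N < 2 ^ (8 * N * (s + 3)) := by
  calc (4 * (8 * N * (s + 3)) + 1) ^ N ≤ (2 ^ (2 * s + 8)) ^ N := by
        gcongr
        exact succ_mul_le_two_pow hN
    _ = 2 ^ ((2 * s + 8) * N) := by rw [← pow_mul]
    _ < 2 ^ (8 * N * (s + 3)) := by
        refine Nat.pow_lt_pow_right (by norm_num) ?_
        nlinarith [Nat.zero_le (N * s)]

theorem sq_pow_le_two_pow {N s : ℕ} (hN : N ≤ 2 ^ s) :
    ((4 * (8 * N * (s + 3)) + 1) ^ 2 + 1) ^ N ≤ 2 ^ (N * (4 * s + 17)) := by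
  have h : (4 * (8 * N * (s + 3)) + 1) ^ 2 + 1 ≤ 2 ^ (4 * s + 17) := by
    have h1 := Nat.pow_le_pow_left (succ_mul_le_two_pow hN) 2
    have h2 : (2 ^ (2 * s + 8)) ^ 2 = 2 ^ (4 * s + 16) := by ring
    have h3 : 2 ^ (4 * s + 17) = 2 * 2 ^ (4 * s + 16) := by ring
    have h4 : 1 ≤ 2 ^ (4 * s + 16) := Nat.one_le_two_pow
    omega
  calc _ ≤ (2 ^ (4 * s + 17)) ^ N := by gcongr
    _ = 2 ^ (N * (4 * s + 17)) := by rw [← pow_mul, mul_comm]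

theorem natLog_succ_le_log {m : ℕ} (hm : 2 ≤ m) :
    ((Nat.log 2 m + 1 : ℕ) : ℝ) ≤ 4 * Real.log m := by
  have h2 : (1 / 2 : ℝ) < Real.log 2 := by linarith [Real.log_two_gt_d9]
  have hle : Real.log 2 ≤ Real.log m := Real.log_le_log (by norm_num) (by exact_mod_cast hm)
  have hpow : (Nat.log 2 m : ℝ) * Real.log 2 ≤ Real.log m := by
    rw [← Real.log_pow]
    refine Real.log_le_log (by positivity) ?_
    exact_mod_cast Nat.pow_log_le_self 2 (by omega)
  have h0 : (0 : ℝ) ≤ Nat.log 2 m := Nat.cast_nonneg _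
  push_cast
  nlinarith

/-- The number of monomials of degree at most `k`. -/
theorem card_monomials_le (m k : ℕ) :
    Fintype.card {S : Finset (Fin m) // S.card ≤ k} ≤ (m + 1) ^ k := by
  have := card_filter_card_le (Finset.univ : Finset (Fin m)) k
  rw [Finset.card_univ, Fintype.card_fin, Finset.powerset_univ] at this
  rwa [Fintype.card_subtype]

theorem depth_bound (k c m ℓ N q : ℕ) (hk : 0 < k) (hm : 2 ≤ m) (hN : 0 < N)
    (hNm : N ≤ (m + 1) ^ k) (hq : q = Nat.log 2 m + 1) :
    ((ℓ * ((m + 1 + q * c) * (2 * (N * (4 * (k * q) + 17) +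
      (4 * (8 * N * (k * q + 3)) + 1)))) : ℕ) : ℝ) ≤
      (1200 * 2 ^ k * k * (c + 2)) * ℓ * (m : ℝ) ^ (k + 1) * Real.log m := by
  have hq1 : 1 ≤ k * q := Nat.mul_pos hk (by omega)
  have hqm : q ≤ m := by
    have := Nat.log_lt_self 2 (show m ≠ 0 by omega)
    omega
  have hR : m + 1 + q * c ≤ m * (c + 2) := by nlinarith [Nat.mul_le_mul_right c hqm]
  have hK : 2 * (N * (4 * (k * q) + 17) + (4 * (8 * N * (k * q + 3)) + 1)) ≤
      300 * (N * (k * q)) := by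
    nlinarith [Nat.mul_le_mul_left N hq1, Nat.mul_pos hN hq1]
  have hNm' : N ≤ 2 ^ k * m ^ k := by
    rw [← mul_pow]
    exact hNm.trans (Nat.pow_le_pow_left (by omega) k)
  have hnat : ℓ * ((m + 1 + q * c) * (2 * (N * (4 * (k * q) + 17) +
      (4 * (8 * N * (k * q + 3)) + 1)))) ≤
      ℓ * (m * (c + 2) * (300 * (2 ^ k * m ^ k * (k * q)))) := by
    refine Nat.mul_le_mul_left _ (Nat.mul_le_mul hR (hK.trans ?_))
    gcongr
  have hlog : (q : ℝ) ≤ 4 * Real.log m := by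
    rw [hq]
    exact natLog_succ_le_log hm
  calc _ ≤ ((ℓ * (m * (c + 2) * (300 * (2 ^ k * m ^ k * (k * q)))) : ℕ) : ℝ) := by
        exact_mod_cast hnat
    _ = (300 * 2 ^ k * k * (c + 2) * ℓ * (m : ℝ) ^ (k + 1)) * q := by
        push_cast
        ring
    _ ≤ (300 * 2 ^ k * k * (c + 2) * ℓ * (m : ℝ) ^ (k + 1)) * (4 * Real.log m) := by gcongr
    _ = _ := by ring

end Parameters

/-- The values of the monomials of degree at most `k` at a point of the cube. -/
def monomialVec {m : ℕ} (k : ℕ) (b : Fin m → Bool) (S : {S : Finset (Fin m) // S.card ≤ k}) : ℤ :=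
  ∏ i ∈ (S : Finset (Fin m)), if b i then 1 else -1

theorem abs_monomialVec_le {m k : ℕ} (b : Fin m → Bool)
    (S : {S : Finset (Fin m) // S.card ≤ k}) : |monomialVec k b S| ≤ 1 := by
  rw [monomialVec, Finset.abs_prod]
  refine Finset.prod_le_one (fun i _ => abs_nonneg _) fun i _ => ?_
  split_ifs <;> simp

theorem formVal_monomialVec {m k : ℕ} (b : Fin m → Bool)
    (x : {S : Finset (Fin m) // S.card ≤ k} → ℝ) :
    formVal (monomialVec k b) x = polyVal x (boolToPM b) := by
  refine Finset.sum_congr rfl fun S _ => ?_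
  simp [monomialVec, boolToPM, mul_comm]

/-- **Corollary 2.1** (without the running-time clause). Fix positive integers `k, c`.
There is `C > 0` such that for all `m ≥ 2` and `1 ≤ ℓ ≤ m^c` there is a finitely
supported distribution over linear decision trees over `ℝ^{r·ℓ}` (inputs are `ℓ`-tuples
of coefficient vectors of degree-`k` multilinear polynomials on `m` variables) of depth
`O(ℓ·m^{k+1}·log m)`, with query coefficients in `{-2,…,2}`, which on every input tuple
whose polynomials do not vanish on `{-1,1}^m` outputs either `?` or the number of common
satisfying assignments of the `k`-PTFs sign-represented by the polynomials, and outputs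
`?` with probability at most `1/2`. -/
theorem klmz_ldt_for_ptf_tuples (k c : ℕ) (hk : 0 < k) (hc : 0 < c) :
    ∃ C : ℝ, 0 < C ∧
      ∀ (m : ℕ), 2 ≤ m → ∀ (ℓ : ℕ), 0 < ℓ → ℓ ≤ m ^ c →
        ∃ D : PMF (LDT (Fin ℓ × {S : Finset (Fin m) // S.card ≤ k}) (Option ℕ)),
          D.support.Finite ∧
          (∀ T ∈ D.support,
            (T.depth : ℝ) ≤ C * ℓ * (m : ℝ) ^ (k + 1) * Real.log m ∧
            T.SmallCoeffs) ∧
          (∀ z : Fin ℓ × {S : Finset (Fin m) // S.card ≤ k} → ℝ,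
            (∀ i : Fin ℓ, ∀ b : Fin m → Bool,
              polyVal (fun S => z (i, S)) (boolToPM b) ≠ 0) →
            (∀ T ∈ D.support,
              T.eval z = none ∨
              T.eval z = some
                (Finset.univ.filter (fun b : Fin m → Bool =>
                  ∀ i : Fin ℓ, polyVal (fun S => z (i, S)) (boolToPM b) < 0)).card) ∧
            D.toOuterMeasure {T | T.eval z = none} ≤ 1 / 2) := by
  classical
  refine ⟨1200 * 2 ^ k * k * (c + 2), by positivity, fun m hm ℓ _ hℓ => ?_⟩
  set N := Fintype.card {S : Finset (Fin m) // S.card ≤ k} with hNdef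
  have hN : 0 < N := Fintype.card_pos_iff.2 ⟨⟨∅, by simp⟩⟩
  obtain ⟨q, hq⟩ : ∃ q, q = Nat.log 2 m + 1 := ⟨_, rfl⟩
  have hmq : m < 2 ^ q := by
    rw [hq]
    exact Nat.lt_pow_succ_log_self (by norm_num) m
  have hNq : N ≤ 2 ^ (k * q) := by
    refine (card_monomials_le m k).trans ((Nat.pow_le_pow_left hmq k).trans_eq ?_)
    rw [← pow_mul, mul_comm]
  obtain ⟨Ω, _, _, T, hT, hfail⟩ := exists_random_sign_trees (monomialVec (m := m) k)
    abs_monomialVec_le (8 * N * (k * q + 3)) (pow_lt_two_pow_of_le hNq hN)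
    (4 * (8 * N * (k * q + 3))) (Nat.le_succ _) _
    (exists_sorting_tree _ abs_monomialVec_le _ (sq_pow_le_two_pow hNq)) (m + 1 + q * c)
  choose T' hd hs hT' using fun ω => exists_counting_tree (ℓ := ℓ) (T ω Finset.univ)
    (hT ω _).2.1 _ (hT ω _).2.2
  refine ⟨(PMF.uniformOfFintype Ω).map T', ?_, ?_, fun z _ => ⟨?_, ?_⟩⟩
  · rw [PMF.support_map]
    exact (Set.toFinite _).image _
  · intro U hU
    rw [PMF.support_map] at hU
    obtain ⟨ω, -, rfl⟩ := hU
    refine ⟨?_, hs ω⟩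
    refine le_trans ?_ (depth_bound k c m ℓ N q hk hm hN (card_monomials_le m k) hq)
    rw [Nat.cast_le]
    exact (hd ω).trans <| Nat.mul_le_mul_left _ (hT ω _).1
  · intro U hU
    rw [PMF.support_map] at hU
    obtain ⟨ω, -, rfl⟩ := hU
    refine (hT' ω z).imp (fun h => h.1) fun h => h.trans ?_
    refine congrArg (fun s => some (Finset.card s)) (Finset.ext fun b => ?_)
    simp [formVal_monomialVec]
  · rw [PMF.toOuterMeasure_map_apply, PMF.toOuterMeasure_uniformOfFintype_apply]
    have hcard : Fintype.card (T' ⁻¹' {U | U.eval z = none}) =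
        (Finset.univ.filter fun ω => (T' ω).eval z = none).card := by
      rw [← Set.toFinset_card]
      congr 1
      ext ω
      simp
    have hunion : (Finset.univ.filter fun ω => (T' ω).eval z = none).card ≤
        ∑ i : Fin ℓ, (Finset.univ.filter fun ω =>
          (T ω Finset.univ).eval (fun S => z (i, S)) = none).card := by
      refine (Finset.card_le_card fun ω hω => ?_).trans Finset.card_biUnion_le
      rw [Finset.mem_filter] at hω
      rcases hT' ω z with ⟨-, i, hi⟩ | h
      · exact Finset.mem_biUnion.2 ⟨i, Finset.mem_univ i, Finset.mem_filter.2 ⟨hω.1, hi⟩⟩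
      · rw [hω.2] at h
        exact absurd h (by simp)
    have hhalf : 2 * (Finset.univ.filter fun ω => (T' ω).eval z = none).card ≤
        Fintype.card Ω := by
      refine Nat.le_of_mul_le_mul_left ?_ (show 0 < 2 ^ (m + q * c) by positivity)
      calc 2 ^ (m + q * c) * (2 * (Finset.univ.filter fun ω => (T' ω).eval z = none).card)
          = 2 ^ (m + 1 + q * c) * (Finset.univ.filter fun ω => (T' ω).eval z = none).card := by
            ring
        _ ≤ 2 ^ (m + 1 + q * c) * ∑ i : Fin ℓ, (Finset.univ.filter fun ω =>
              (T ω Finset.univ).eval (fun S => z (i, S)) = none).card :=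
            Nat.mul_le_mul_left _ hunion
        _ = ∑ i : Fin ℓ, 2 ^ (m + 1 + q * c) * (Finset.univ.filter fun ω =>
              (T ω Finset.univ).eval (fun S => z (i, S)) = none).card := Finset.mul_sum _ _ _
        _ ≤ ∑ _i : Fin ℓ, 2 ^ m * Fintype.card Ω := by
            refine Finset.sum_le_sum fun i _ => ?_
            simpa using hfail Finset.univ (fun S => z (i, S))
        _ = ℓ * (2 ^ m * Fintype.card Ω) := by simp
        _ ≤ 2 ^ (q * c) * (2 ^ m * Fintype.card Ω) := by
            refine Nat.mul_le_mul_right _ (hℓ.trans ?_)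
            rw [pow_mul]
            exact Nat.pow_le_pow_left hmq.le c
        _ = 2 ^ (m + q * c) * Fintype.card Ω := by ring
    rw [hcard]
    refine ENNReal.div_le_of_le_mul ?_
    rw [one_div, ← ENNReal.div_eq_inv_mul, ENNReal.le_div_iff_mul_le (by simp) (by simp), mul_comm]
    exact_mod_cast hhalf
end
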